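/- arXiv:2507.07594 — 6 statements merged into one kernel-verified Lean document; each statement's English description precedes it below -/
import Mathlib

section
/- For every integer k ≥ 1 there exists c_k > 0 such that for every integer n ≥ k and every integer r ≥ c_k·n^{H_k} there exist δ > 0 and q_0 such that for every prime power q ≥ q_0, the number of (k,r)-evasive subsets of 𝔽_q^n is at least 2^{δ·q^{n−k}}. (Every subset of a (k,r)-evasive set is (k,r)-evasive, so this follows from the existence of a (k,r)-evasive set of size Ω(q^{n−k}).) -/
section Evasive

open MvPolynomial

section AffineHilbertFunction

variable {F σ : Type*} [Field F]

/-- The affine Hilbert function of an ideal `I`: the dimension of the space of polynomials of total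
degree at most `m` modulo `I`. -/
noncomputable def affineHilbert (I : Ideal (MvPolynomial σ F)) (m : ℕ) : ℕ :=
  Module.finrank F ((restrictTotalDegree σ F m).map (Ideal.Quotient.mkₐ F I).toLinearMap)

theorem restrictTotalDegree_mono {m m' : ℕ} (h : m ≤ m') :
    restrictTotalDegree σ F m ≤ restrictTotalDegree σ F m' := fun p hp => by
  rw [mem_restrictTotalDegree] at hp ⊢
  exact hp.trans h

theorem finrank_map_le_of_ker_le {V W W' : Type*} [AddCommGroup V] [Module F V]
    [AddCommGroup W] [Module F W] [AddCommGroup W'] [Module F W'] (N : Submodule F V)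
    [FiniteDimensional F N] (u : V →ₗ[F] W) (v : V →ₗ[F] W') (h : ∀ x, u x = 0 → v x = 0) :
    Module.finrank F (N.map v) ≤ Module.finrank F (N.map u) := by
  have hu := (u.domRestrict N).finrank_range_add_finrank_ker
  have hv := (v.domRestrict N).finrank_range_add_finrank_ker
  rw [LinearMap.range_domRestrict] at hu hv
  have hker : LinearMap.ker (u.domRestrict N) ≤ LinearMap.ker (v.domRestrict N) :=
    fun x hx => h _ hx
  have := Submodule.finrank_mono hker
  omega

variable [Finite σ]

theorem affineHilbert_mono (I : Ideal (MvPolynomial σ F)) : Monotone (affineHilbert I) :=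
  fun _ _ h => Submodule.finrank_mono (Submodule.map_mono (restrictTotalDegree_mono h))

theorem affineHilbert_anti {I J : Ideal (MvPolynomial σ F)} (h : I ≤ J) (m : ℕ) :
    affineHilbert J m ≤ affineHilbert I m := by
  refine finrank_map_le_of_ker_le _ _ _ fun x hx => ?_
  exact Ideal.Quotient.eq_zero_iff_mem.2 (h (Ideal.Quotient.eq_zero_iff_mem.1 hx))

theorem affineHilbert_add_le {I J K : Ideal (MvPolynomial σ F)} (hIJ : I ≤ J)
    {g : MvPolynomial σ F} (hg : g ∈ J) (hK : ∀ p, g * p ∈ I → p ∈ K) {d : ℕ}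
    (hd : g.totalDegree ≤ d) (m : ℕ) :
    affineHilbert J (m + d) + affineHilbert K m ≤ affineHilbert I (m + d) := by
  let f : (MvPolynomial σ F ⧸ I) →ₗ[F] (MvPolynomial σ F ⧸ J) :=
    (Ideal.Quotient.factorₐ F hIJ).toLinearMap
  let N := (restrictTotalDegree σ F (m + d)).map (Ideal.Quotient.mkₐ F I).toLinearMap
  let u : MvPolynomial σ F →ₗ[F] (MvPolynomial σ F ⧸ I) :=
    (Ideal.Quotient.mkₐ F I).toLinearMap ∘ₗ LinearMap.mulLeft F g
  have key := (f.domRestrict N).finrank_range_add_finrank_ker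
  have h1 : LinearMap.range (f.domRestrict N) =
      (restrictTotalDegree σ F (m + d)).map (Ideal.Quotient.mkₐ F J).toLinearMap := by
    rw [LinearMap.range_domRestrict, ← Submodule.map_comp]
    rfl
  have h2 : affineHilbert K m ≤ Module.finrank F ((restrictTotalDegree σ F m).map u) :=
    finrank_map_le_of_ker_le _ _ _ fun x hx =>
      Ideal.Quotient.eq_zero_iff_mem.2 (hK _ (Ideal.Quotient.eq_zero_iff_mem.1 hx))
  have h3 : (restrictTotalDegree σ F m).map u ≤
      (LinearMap.ker (f.domRestrict N)).map N.subtype := by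
    rintro _ ⟨p, hp, rfl⟩
    have hp' : p.totalDegree ≤ m := (mem_restrictTotalDegree _ _ _).1 hp
    have hmem : u p ∈ N := by
      refine ⟨g * p, ?_, rfl⟩
      refine (mem_restrictTotalDegree _ _ _).2 ((totalDegree_mul _ _).trans ?_)
      omega
    refine ⟨⟨u p, hmem⟩, ?_, rfl⟩
    exact Ideal.Quotient.eq_zero_iff_mem.2 (J.mul_mem_right p hg)
  have h4 := (Submodule.finrank_mono h3).trans (Submodule.finrank_map_le _ _)
  rw [h1] at key
  change affineHilbert J (m + d) + _ = affineHilbert I (m + d) at key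
  omega

theorem mul_affineHilbert_le {I J : Ideal (MvPolynomial σ F)} (hIJ : I ≤ J)
    {g : MvPolynomial σ F} (hg : g ∈ J) (hI : ∀ p, g * p ∈ I → p ∈ I) {d : ℕ}
    (hd : g.totalDegree ≤ d) (m T : ℕ) :
    T * affineHilbert J m ≤ affineHilbert I (m + T * d) := by
  induction T with
  | zero => simp
  | succ T ih =>
    have h := affineHilbert_add_le hIJ hg hI hd (m + T * d)
    have h' : affineHilbert J m ≤ affineHilbert J (m + T * d + d) :=
      affineHilbert_mono J (by omega)
    have e : m + (T + 1) * d = m + T * d + d := by ring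
    rw [e, Nat.succ_mul]
    omega

theorem exists_sum_affineHilbert_le (I : Ideal (MvPolynomial σ F))
    (s : Finset (Ideal (MvPolynomial σ F))) (hprime : ∀ P ∈ s, P.IsPrime) (hle : ∀ P ∈ s, I ≤ P)
    (hanti : ∀ P ∈ s, ∀ Q ∈ s, P ≤ Q → P = Q) :
    ∃ e, ∀ m, ∑ P ∈ s, affineHilbert P m ≤ affineHilbert I (m + e) := by
  classical
  suffices H : ∃ e, ∀ m, ∑ P ∈ s, affineHilbert P m ≤ affineHilbert (s.inf id) (m + e) by
    obtain ⟨e, he⟩ := H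
    exact ⟨e, fun m => (he m).trans (affineHilbert_anti (Finset.le_inf hle) _)⟩
  clear hle
  induction s using Finset.induction_on with
  | empty => exact ⟨0, by simp⟩
  | insert P s hP ih =>
    obtain ⟨e, he⟩ := ih (fun Q hQ => hprime Q (Finset.mem_insert_of_mem hQ))
      (fun Q hQ R hR => hanti Q (Finset.mem_insert_of_mem hQ) R (Finset.mem_insert_of_mem hR))
    have hPp := hprime P (Finset.mem_insert_self _ _)
    have hnot : ¬ s.inf id ≤ P := by
      intro h
      obtain ⟨Q, hQ, hQP⟩ := (Ideal.IsPrime.inf_le' hPp).1 h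
      exact hP (hanti Q (Finset.mem_insert_of_mem hQ) P (Finset.mem_insert_self _ _) hQP ▸ hQ)
    obtain ⟨g, hg, hgP⟩ := SetLike.not_le_iff_exists.1 hnot
    refine ⟨e + g.totalDegree, fun m => ?_⟩
    rw [Finset.sum_insert hP, Finset.inf_insert, id]
    have h := affineHilbert_add_le (I := P ⊓ s.inf id) (J := s.inf id) (K := P) inf_le_right hg
      (fun p hp => (hPp.mem_or_mem hp.1).resolve_left hgP) le_rfl (m + e)
    have h' := affineHilbert_mono P (show m ≤ m + e by omega)
    have := he m
    have h'' := affineHilbert_mono (s.inf id) (show m + e ≤ m + e + g.totalDegree by omega)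
    rw [← add_assoc]
    omega

theorem one_le_affineHilbert {P : Ideal (MvPolynomial σ F)} (hP : P ≠ ⊤) (m : ℕ) :
    1 ≤ affineHilbert P m := by
  refine Submodule.one_le_finrank_iff.2 fun h => hP ((Ideal.eq_top_iff_one _).2 ?_)
  have h1 : (Ideal.Quotient.mkₐ F P).toLinearMap 1 ∈
      (restrictTotalDegree σ F m).map (Ideal.Quotient.mkₐ F P).toLinearMap :=
    Submodule.mem_map_of_mem ((mem_restrictTotalDegree _ _ _).2 (by simp))
  rw [h, Submodule.mem_bot] at h1
  exact Ideal.Quotient.eq_zero_iff_mem.1 h1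

theorem affineHilbert_le_pow {k : ℕ} (I : Ideal (MvPolynomial (Fin k) F)) (m : ℕ) :
    affineHilbert I m ≤ (m + 1) ^ k := by
  classical
  let S : Finset (Fin k →₀ ℕ) := Finset.univ.image fun s : Fin k → Fin (m + 1) =>
    Finsupp.equivFunOnFinite.symm fun i => (s i : ℕ)
  have hle : restrictTotalDegree (Fin k) F m ≤
      Submodule.span F (S.image fun s => monomial s (1 : F) : Finset (MvPolynomial (Fin k) F)) := by
    intro p hp
    rw [mem_restrictTotalDegree] at hp
    rw [p.as_sum]
    refine Submodule.sum_mem _ fun s hs => ?_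
    have : monomial s (coeff s p) = coeff s p • (monomial s (1 : F)) := by simp [smul_monomial]
    rw [this]
    refine Submodule.smul_mem _ _ (Submodule.subset_span ?_)
    refine Finset.mem_coe.2 (Finset.mem_image_of_mem _ (Finset.mem_image.2 ?_))
    have hb : ∀ i, s i < m + 1 := fun i => by
      have := monomial_le_degreeOf i hs
      have := degreeOf_le_totalDegree p i
      omega
    exact ⟨fun i => ⟨s i, hb i⟩, Finset.mem_univ _, by ext i; simp⟩
  calc affineHilbert I m ≤ Module.finrank F (restrictTotalDegree (Fin k) F m) :=
        Submodule.finrank_map_le _ _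
    _ ≤ _ := Submodule.finrank_mono hle
    _ ≤ _ := finrank_span_finset_le_card _
    _ ≤ S.card := Finset.card_image_le
    _ ≤ _ := Finset.card_image_le
    _ = (m + 1) ^ k := by simp

end AffineHilbertFunction

section Height

variable {F : Type*} [Field F]

theorem le_height_map_C {R : Type*} [CommRing R] [IsNoetherianRing R] (p : Ideal R) [p.IsPrime] :
    p.height ≤ (p.map Polynomial.C).height := by
  have : (p.map Polynomial.C).LiesOver p := ⟨by
    ext x
    simp only [Ideal.under_def, Ideal.mem_comap, Polynomial.algebraMap_eq, Ideal.mem_map_C_iff]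
    refine ⟨fun h n => ?_, fun h => by simpa using h 0⟩
    rw [Polynomial.coeff_C]
    split_ifs
    exacts [h, p.zero_mem]⟩
  rw [Ideal.height_eq_height_add_of_liesOver_of_hasGoingDown p (p.map Polynomial.C)]
  exact le_self_add

theorem finSuccEquiv_rename_cons {a k : ℕ} (e : Fin a → Fin k) (g : MvPolynomial (Fin (a + 1)) F) :
    finSuccEquiv F k (rename (Fin.cons 0 (Fin.succ ∘ e)) g) =
      (finSuccEquiv F a g).map (rename e : _ →ₐ[F] _).toRingHom := by
  have : ((finSuccEquiv F k).toAlgHom.comp (rename (Fin.cons 0 (Fin.succ ∘ e)))) =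
      (Polynomial.mapAlgHom (rename e)).comp (finSuccEquiv F a).toAlgHom := by
    refine algHom_ext fun i => ?_
    refine Fin.cases ?_ (fun j => ?_) i
    · simp [finSuccEquiv_X_zero]
    · simp [finSuccEquiv_X_succ]
  exact congrArg (fun φ => φ g) this

theorem finSuccEquiv_rename_succ {k : ℕ} (h : MvPolynomial (Fin k) F) :
    finSuccEquiv F k (rename Fin.succ h) = Polynomial.C h := by
  have : ((finSuccEquiv F k).toAlgHom.comp (rename Fin.succ)) =
      IsScalarTower.toAlgHom F (MvPolynomial (Fin k) F) (Polynomial (MvPolynomial (Fin k) F)) := by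
    refine algHom_ext fun i => ?_
    simp [finSuccEquiv_X_succ]
  exact congrArg (fun φ => φ h) this

/-- Modulo a prime `P`, at least `k - height P` of the coordinates are algebraically independent. -/
theorem exists_rename_mem_imp_eq_zero (k : ℕ) (P : Ideal (MvPolynomial (Fin k) F)) [P.IsPrime] :
    ∃ (a : ℕ) (e : Fin a → Fin k), Function.Injective e ∧ (k : ℕ∞) ≤ a + P.height ∧
      ∀ g : MvPolynomial (Fin a) F, rename e g ∈ P → g = 0 := by
  induction k with
  | zero =>
    refine ⟨0, id, Function.injective_id, by simp, fun g hg => ?_⟩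
    by_contra hne
    rw [rename_id] at hg
    refine (‹P.IsPrime›).ne_top (Ideal.eq_top_of_isUnit_mem _ hg ?_)
    rw [eq_C_of_isEmpty g] at hne ⊢
    refine (IsUnit.mk0 _ fun h => hne ?_).map C
    rw [h, C_0]
  | succ k ih =>
    let E := (finSuccEquiv F k).toRingEquiv
    let Q : Ideal (Polynomial (MvPolynomial (Fin k) F)) := P.comap E.symm
    have hQP : Q.height = P.height := E.symm.height_comap P
    have hmem : ∀ f, f ∈ P ↔ finSuccEquiv F k f ∈ Q := fun f => by
      change f ∈ P ↔ E.symm (E f) ∈ P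
      rw [E.symm_apply_apply]
    have : Q.IsPrime := Ideal.comap_isPrime _ _
    let p := Q.comap Polynomial.C
    have : p.IsPrime := Ideal.comap_isPrime _ _
    obtain ⟨a, e, he, hk, hind⟩ := ih p
    have hle : p.map Polynomial.C ≤ Q := Ideal.map_comap_le
    have hh := le_height_map_C p
    rw [← hQP]
    rcases hle.eq_or_lt with heq | hlt
    · refine ⟨a + 1, Fin.cons 0 (Fin.succ ∘ e), ?_, ?_, fun g hg => ?_⟩
      · refine Fin.cons_injective_iff.2 ⟨?_, (Fin.succ_injective _).comp he⟩
        rintro ⟨i, hi⟩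
        exact Fin.succ_ne_zero _ hi
      · rw [heq] at hh
        push_cast
        calc (k : ℕ∞) + 1 ≤ a + p.height + 1 := by gcongr
          _ ≤ a + Q.height + 1 := by gcongr
          _ = _ := by ring
      · rw [hmem, finSuccEquiv_rename_cons, ← heq, Ideal.mem_map_C_iff] at hg
        have : finSuccEquiv F a g = 0 := by
          ext1 n
          refine hind _ ?_
          simpa using hg n
        simpa using this
    · refine ⟨a, Fin.succ ∘ e, (Fin.succ_injective _).comp he, ?_, fun g hg => ?_⟩
      · have := Ideal.height_add_one_le_of_lt_of_isPrime hlt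
        push_cast
        calc (k : ℕ∞) + 1 ≤ a + p.height + 1 := by gcongr
          _ ≤ a + (p.map Polynomial.C).height + 1 := by gcongr
          _ = a + ((p.map Polynomial.C).height + 1) := by ring
          _ ≤ _ := by gcongr
      · rw [hmem, ← rename_rename, finSuccEquiv_rename_succ] at hg
        exact hind _ hg

theorem pow_le_affineHilbert {k i : ℕ} (P : Ideal (MvPolynomial (Fin k) F)) [P.IsPrime]
    (hP : P.height ≤ i) (t : ℕ) : (t + 1) ^ (k - i) ≤ affineHilbert P (k * t) := by
  obtain ⟨a, e, he, hk, hind⟩ := exists_rename_mem_imp_eq_zero k P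
  have hka : k ≤ a + i := by
    have : (k : ℕ∞) ≤ a + i := hk.trans (by gcongr)
    exact_mod_cast this
  have hak : a ≤ k := by simpa using Fintype.card_le_of_injective e he
  let L : MvPolynomial (Fin a) F →ₗ[F] (MvPolynomial (Fin k) F ⧸ P) :=
    ((Ideal.Quotient.mkₐ F P).comp (rename e)).toLinearMap
  have hL : LinearMap.ker L = ⊥ := by
    refine LinearMap.ker_eq_bot'.2 fun g hg => hind g ?_
    exact Ideal.Quotient.eq_zero_iff_mem.1 hg
  let ν : (Fin a → Fin (t + 1)) → (Fin a →₀ ℕ) := fun s =>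
    Finsupp.equivFunOnFinite.symm fun i => (s i : ℕ)
  have hν : Function.Injective ν := fun s s' h => by
    ext i
    simpa [ν] using DFunLike.congr_fun h i
  have hli : LinearIndependent F (fun s => L (monomial (ν s) 1)) := by
    have := ((basisMonomials (Fin a) F).linearIndependent.comp ν hν).map' L hL
    simpa [Function.comp_def] using this
  have hspan : Submodule.span F (Set.range fun s => L (monomial (ν s) 1)) ≤
      (restrictTotalDegree (Fin k) F (k * t)).map (Ideal.Quotient.mkₐ F P).toLinearMap := by
    rw [Submodule.span_le]
    rintro _ ⟨s, rfl⟩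
    refine ⟨rename e (monomial (ν s) 1), ?_, rfl⟩
    refine (mem_restrictTotalDegree _ _ _).2 ((totalDegree_rename_le _ _).trans ?_)
    refine (totalDegree_monomial_le _ _).trans ?_
    rw [Finsupp.sum_fintype _ _ (fun _ => rfl)]
    calc ∑ i, (ν s i) ≤ ∑ _i : Fin a, t := Finset.sum_le_sum fun i _ => by
          simpa [ν] using Nat.lt_succ_iff.1 (s i).2
      _ = a * t := by simp
      _ ≤ k * t := Nat.mul_le_mul_right _ hak
  calc (t + 1) ^ (k - i) ≤ (t + 1) ^ a := Nat.pow_le_pow_right (by omega) (by omega)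
    _ = Module.finrank F (Submodule.span F (Set.range fun s => L (monomial (ν s) 1))) := by
        rw [finrank_span_eq_card hli]; simp
    _ ≤ _ := Submodule.finrank_mono hspan

end Height

section Growth

variable {F : Type*} [Field F]

theorem affineHilbert_growth_step {σ : Type*} [Finite σ] {I J : Ideal (MvPolynomial σ F)}
    (hIJ : I ≤ J) {g : MvPolynomial σ F} (hg : g ∈ J) (hI : ∀ p, g * p ∈ I → p ∈ I) {d : ℕ}
    (hd : g.totalDegree ≤ d) (hd0 : 0 < d) {a D m₀ : ℕ}
    (h : ∀ m ≥ m₀, affineHilbert I m ≤ D * m ^ (a + 1)) :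
    ∀ m ≥ max m₀ d, affineHilbert J m ≤ 2 ^ (a + 2) * d * D * m ^ a := by
  intro m hm
  have hm0 : m₀ ≤ m := le_of_max_le_left hm
  have hmd : d ≤ m := le_of_max_le_right hm
  have h1 : m / d * d ≤ m := Nat.div_mul_le_self m d
  have h2 : m ≤ 2 * (m / d * d) := by
    have := Nat.div_add_mod m d
    have := Nat.mod_lt m hd0
    have : d ≤ m / d * d := Nat.le_mul_of_pos_left d (Nat.div_pos hmd hd0)
    nlinarith
  have h3 := mul_affineHilbert_le hIJ hg hI hd m (m / d)
  have h4 : affineHilbert I (m + m / d * d) ≤ affineHilbert I (2 * m) :=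
    affineHilbert_mono I (by omega)
  have h5 := h (2 * m) (by omega)
  refine Nat.le_of_mul_le_mul_left ?_ (hd0.trans_le hmd)
  calc m * affineHilbert J m ≤ 2 * (m / d * d) * affineHilbert J m := Nat.mul_le_mul_right _ h2
    _ = 2 * d * (m / d * affineHilbert J m) := by ring
    _ ≤ 2 * d * (D * (2 * m) ^ (a + 1)) := Nat.mul_le_mul_left _ (h3.trans (h4.trans h5))
    _ = m * (2 ^ (a + 2) * d * D * m ^ a) := by ring

theorem card_le_of_affineHilbert_growth {k : ℕ} (hk : 0 < k) {I : Ideal (MvPolynomial (Fin k) F)}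
    (s : Finset (Ideal (MvPolynomial (Fin k) F))) (hprime : ∀ P ∈ s, P.IsPrime)
    (hle : ∀ P ∈ s, I ≤ P) (hanti : ∀ P ∈ s, ∀ Q ∈ s, P ≤ Q → P = Q) {a D m₀ : ℕ}
    (hlow : ∀ P ∈ s, ∀ t, (t + 1) ^ a ≤ affineHilbert P (k * t))
    (h : ∀ m ≥ m₀, affineHilbert I m ≤ D * m ^ a) : s.card ≤ D * (2 * k) ^ a := by
  obtain ⟨e, he⟩ := exists_sum_affineHilbert_le I s hprime hle hanti
  let t := m₀ + e + 1
  have ht : t ≤ k * t := Nat.le_mul_of_pos_left t hk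
  refine Nat.le_of_mul_le_mul_right (c := t ^ a) ?_ (by positivity)
  calc s.card * t ^ a ≤ s.card * (t + 1) ^ a := by gcongr; omega
    _ = ∑ _P ∈ s, (t + 1) ^ a := by simp
    _ ≤ ∑ P ∈ s, affineHilbert P (k * t) := Finset.sum_le_sum fun P hP => hlow P hP t
    _ ≤ affineHilbert I (k * t + e) := he _
    _ ≤ D * (k * t + e) ^ a := h _ (by omega)
    _ ≤ D * (2 * k * t) ^ a := by gcongr; rw [mul_assoc]; omega
    _ = D * (2 * k) ^ a * t ^ a := by rw [mul_pow, mul_assoc]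

theorem mem_radical_of_mul_mem_radical {R : Type*} [CommRing R] {I : Ideal R} {g p : R}
    (hg : ∀ P ∈ I.minimalPrimes, g ∉ P) (h : g * p ∈ I.radical) : p ∈ I.radical := by
  rw [← Ideal.sInf_minimalPrimes, Ideal.mem_sInf] at h ⊢
  intro P hP
  exact (hP.1.1.mem_or_mem (h hP)).resolve_left (hg P hP)

theorem ncard_minimalPrimes_le {k i : ℕ} (hk : 0 < k) {s : Set (MvPolynomial (Fin k) F)}
    (hs : s.Finite) (hcard : s.ncard ≤ i) {D m₀ : ℕ}
    (h : ∀ m ≥ m₀, affineHilbert (Ideal.span s).radical m ≤ D * m ^ (k - i)) :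
    (Ideal.span s).minimalPrimes.ncard ≤ D * (2 * k) ^ (k - i) := by
  have hfin := (Ideal.span s).finite_minimalPrimes_of_isNoetherianRing
  rw [Set.ncard_eq_toFinset_card _ hfin]
  refine card_le_of_affineHilbert_growth hk _ (fun P hP => ?_) (fun P hP => ?_)
    (fun P hP Q hQ hPQ => ?_) (fun P hP t => ?_) h
  · exact (hfin.mem_toFinset.1 hP).1.1
  · have hP' := hfin.mem_toFinset.1 hP
    exact hP'.1.1.isRadical.radical_le_iff.2 hP'.1.2
  · rw [Set.Finite.mem_toFinset] at hP hQ
    exact le_antisymm hPQ (hQ.2 hP.1 hPQ)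
  · rw [Set.Finite.mem_toFinset] at hP
    have := hP.1.1
    refine pow_le_affineHilbert P ?_ t
    exact (Ideal.height_le_card_of_mem_minimalPrimes_span hs hP).trans (by exact_mod_cast hcard)

theorem ncard_zeros_le {k : ℕ} (hk : 0 < k) {I : Ideal (MvPolynomial (Fin k) F)}
    {Y : Set (Fin k → F)} (hY : Y.Finite) (hI : ∀ y ∈ Y, ∀ p ∈ I, eval y p = 0) {D m₀ : ℕ}
    (h : ∀ m ≥ m₀, affineHilbert I.radical m ≤ D) : Y.ncard ≤ D := by
  classical
  have hle : ∀ y z : Fin k → F, RingHom.ker (eval y) ≤ RingHom.ker (eval z) → y = z := by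
    intro y z hyz
    ext j
    have h1 : X j - C (y j) ∈ RingHom.ker (eval y) := by simp [RingHom.mem_ker]
    have h2 := hyz h1
    simp only [RingHom.mem_ker, map_sub, eval_X, eval_C] at h2
    exact (sub_eq_zero.1 h2).symm
  rw [Set.ncard_eq_toFinset_card _ hY,
    ← Finset.card_image_of_injective _ (fun y z hyz => hle y z (le_of_eq hyz) :
      Function.Injective fun y : Fin k → F => RingHom.ker (eval y))]
  have key := card_le_of_affineHilbert_growth hk (I := I.radical)
    (hY.toFinset.image fun y => RingHom.ker (eval y)) (a := 0) (D := D) (m₀ := m₀)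
    ?_ ?_ ?_ ?_ (by simpa using h)
  · simpa using key
  all_goals simp only [Finset.mem_image, Set.Finite.mem_toFinset, forall_exists_index, and_imp,
    forall_apply_eq_imp_iff₂]
  · exact fun y _ => RingHom.ker_isPrime _
  · exact fun y hy => (RingHom.ker_isPrime (eval y)).isRadical.radical_le_iff.2
      fun p hp => hI y hy p hp
  · exact fun y _ z _ hyz => congrArg (fun y => RingHom.ker (eval y)) (hle y z hyz)
  · exact fun y _ t => by simpa using one_le_affineHilbert (RingHom.ker_isPrime (eval y)).ne_top _

end Growth

section AffineSubstitution

variable {F : Type*} [Field F] {k n : ℕ}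

theorem totalDegree_aeval_le {σ τ : Type*} (g : σ → MvPolynomial τ F)
    (hg : ∀ j, (g j).totalDegree ≤ 1) (p : MvPolynomial σ F) :
    (aeval g p).totalDegree ≤ p.totalDegree := by
  rw [aeval_def, eval₂_eq]
  refine totalDegree_finsetSum_le fun s hs => ?_
  refine (totalDegree_mul _ _).trans ?_
  rw [algebraMap_eq, totalDegree_C, zero_add]
  refine (totalDegree_finsetProd _ _).trans (le_trans ?_ (le_totalDegree hs))
  refine Finset.sum_le_sum fun j _ => (totalDegree_pow _ _).trans ?_
  simpa using Nat.mul_le_mul_left (s j) (hg j)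

/-- Pullback of polynomials along the affine map `y ↦ b + ∑ l, y l • v l`, where `φ = (v, b)`. -/
noncomputable def affineSubst (φ : (Fin k → Fin n → F) × (Fin n → F)) :
    MvPolynomial (Fin n) F →ₐ[F] MvPolynomial (Fin k) F :=
  aeval fun j => C (φ.2 j) + ∑ l, C (φ.1 l j) * X l

theorem eval_affineSubst (φ : (Fin k → Fin n → F) × (Fin n → F)) (y : Fin k → F)
    (f : MvPolynomial (Fin n) F) :
    eval y (affineSubst φ f) = eval (φ.2 + ∑ l, y l • φ.1 l) f := by
  have : (aeval y).comp (affineSubst φ) =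
      (aeval (φ.2 + ∑ l, y l • φ.1 l) : MvPolynomial (Fin n) F →ₐ[F] F) := by
    refine algHom_ext fun j => ?_
    simp [affineSubst, mul_comm]
  exact congrArg (fun ψ => ψ f) this

theorem totalDegree_C_add_sum_C_mul_X_le {σ ι : Type*} [Fintype ι] (c : F) (u : ι → F)
    (v : ι → MvPolynomial σ F) (hv : ∀ l, (v l).totalDegree ≤ 1) :
    (C c + ∑ l, C (u l) * v l).totalDegree ≤ 1 := by
  refine (totalDegree_add _ _).trans (max_le (by simp) ?_)
  refine totalDegree_finsetSum_le fun l _ => (totalDegree_mul _ _).trans ?_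
  simpa using hv l

theorem totalDegree_affineSubst_le (φ : (Fin k → Fin n → F) × (Fin n → F))
    (f : MvPolynomial (Fin n) F) : (affineSubst φ f).totalDegree ≤ f.totalDegree :=
  totalDegree_aeval_le _ (fun _ => totalDegree_C_add_sum_C_mul_X_le _ _ _ fun l => by simp) f

theorem exists_affineSubst_eq (φ : (Fin k → Fin n → F) × (Fin n → F))
    (hφ : LinearIndependent F φ.1) (p : MvPolynomial (Fin k) F) :
    ∃ f : MvPolynomial (Fin n) F, f.totalDegree ≤ p.totalDegree ∧ affineSubst φ f = p := by
  obtain ⟨w, hw⟩ : ∃ w : Fin k → Fin n → F,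
      ∀ l l', ∑ j, w l j * φ.1 l' j = if l = l' then 1 else 0 := by
    obtain ⟨g, hg⟩ := (Fintype.linearCombination F φ.1).exists_leftInverse_of_injective
      (LinearMap.ker_eq_bot.2 hφ.fintypeLinearCombination_injective)
    refine ⟨fun l j => g (Pi.single j 1) l, fun l l' => ?_⟩
    have h1 : g (φ.1 l') = Pi.single l' 1 := by
      have := congrArg (fun h => h (Pi.single l' 1)) hg
      simpa [Fintype.linearCombination_apply_single] using this
    have h2 : g (φ.1 l') l = ∑ j, g (Pi.single j 1) l * φ.1 l' j := by
      conv_lhs => rw [← Finset.univ_sum_single (φ.1 l'), map_sum, Finset.sum_apply]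
      refine Finset.sum_congr rfl fun j _ => ?_
      have : (Pi.single j (φ.1 l' j) : Fin n → F) = φ.1 l' j • Pi.single j 1 := by
        rw [← Pi.single_smul, smul_eq_mul, mul_one]
      rw [this, map_smul, Pi.smul_apply, smul_eq_mul, mul_comm]
    rw [← h2, h1, Pi.single_apply]
  let u : Fin k → MvPolynomial (Fin n) F := fun l =>
    C (- ∑ j, w l j * φ.2 j) + ∑ j, C (w l j) * X j
  refine ⟨aeval u p, totalDegree_aeval_le u
    (fun l => totalDegree_C_add_sum_C_mul_X_le _ _ _ fun j => by simp) p, ?_⟩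
  have : (affineSubst φ).comp (aeval u) = AlgHom.id F _ := by
    refine algHom_ext fun l => ?_
    have h1 : ∀ c, affineSubst φ (C c) = C c := fun c => (affineSubst φ).commutes c
    have h2 : ∀ j, affineSubst φ (X j) = C (φ.2 j) + ∑ l', C (φ.1 l' j) * X l' := fun j => by
      simp [affineSubst]
    rw [AlgHom.comp_apply, aeval_X, AlgHom.id_apply]
    simp only [u, map_add, map_sum, map_mul, h1, h2, mul_add, Finset.sum_add_distrib, map_neg]
    rw [neg_add_cancel_left]
    simp only [Finset.mul_sum]
    rw [Finset.sum_comm]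
    simp only [← mul_assoc, ← Finset.sum_mul, ← map_mul, ← map_sum, hw]
    simp
  exact congrArg (fun ψ => ψ p) this

end AffineSubstitution

section Counting

variable {F : Type*} [Field F] [Finite F]

theorem ncard_fiber_mul_pow_le {V W : Type*} [AddCommGroup V] [Module F V] [Finite V]
    [AddCommGroup W] [Module F W] (L : V →ₗ[F] W) (w : W) {B : ℕ}
    (hB : B ≤ Module.finrank F (LinearMap.range L)) :
    {v | L v = w}.ncard * Nat.card F ^ B ≤ Nat.card V := by
  have h1 : {v | L v = w}.ncard ≤ Nat.card (LinearMap.ker L) := by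
    rcases Set.eq_empty_or_nonempty {v | L v = w} with h | ⟨v₀, hv₀⟩
    · simp [h]
    · change _ ≤ (LinearMap.ker L : Set V).ncard
      refine Set.ncard_le_ncard_of_injOn (fun v => v - v₀) (fun v hv => ?_)
        (fun v _ v' _ h => sub_left_injective h) (Set.toFinite _)
      change L (v - v₀) = 0
      rw [map_sub, hv, hv₀, sub_self]
  have h2 := L.finrank_range_add_finrank_ker
  rw [Module.natCard_eq_pow_finrank (K := F)] at h1
  rw [Module.natCard_eq_pow_finrank (K := F) (V := V), ← h2, pow_add, mul_comm]
  exact Nat.mul_le_mul (Nat.pow_le_pow_right Nat.card_pos hB) h1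

end Counting

section Construction

variable {F : Type*} [Field F] {k n : ℕ}

/-- The radical ideal of the section of the zero set of `G` by an affine parametrization. -/
noncomputable def sectionIdeal (G : Finset (MvPolynomial (Fin n) F))
    (φ : (Fin k → Fin n → F) × (Fin n → F)) : Ideal (MvPolynomial (Fin k) F) :=
  (Ideal.span (affineSubst φ '' G)).radical

variable [Finite F]

theorem ncard_affineSubst_mem_mul_pow_le (φ : (Fin k → Fin n → F) × (Fin n → F))
    (hφ : LinearIndependent F φ.1) (P : Ideal (MvPolynomial (Fin k) F)) (c : F) {d B : ℕ}
    (hB : B ≤ affineHilbert P d) [Finite (restrictTotalDegree (Fin n) F d)] :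
    {f : restrictTotalDegree (Fin n) F d |
        affineSubst φ ((f : MvPolynomial (Fin n) F) + C c) ∈ P}.ncard * Nat.card F ^ B ≤
      Nat.card (restrictTotalDegree (Fin n) F d) := by
  let L : restrictTotalDegree (Fin n) F d →ₗ[F] (MvPolynomial (Fin k) F ⧸ P) :=
    ((Ideal.Quotient.mkₐ F P).comp (affineSubst φ)).toLinearMap ∘ₗ Submodule.subtype _
  have hL : B ≤ Module.finrank F (LinearMap.range L) := by
    refine hB.trans (Submodule.finrank_mono ?_)
    rintro _ ⟨p, hp, rfl⟩
    obtain ⟨f, hf, rfl⟩ := exists_affineSubst_eq φ hφ p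
    have hp' : (affineSubst φ f).totalDegree ≤ d := (mem_restrictTotalDegree _ _ _).1 hp
    exact ⟨⟨f, (mem_restrictTotalDegree _ _ _).2 (hf.trans hp')⟩, rfl⟩
  convert! ncard_fiber_mul_pow_le L (-(Ideal.Quotient.mk P (C c))) hL using 4
  funext f
  refine propext ?_
  rw [← Ideal.Quotient.eq_zero_iff_mem, map_add, map_add,
    show affineSubst φ (C c) = C c from (affineSubst φ).commutes c, add_eq_zero_iff_eq_neg]
  rfl

theorem exists_forall_affineSubst_notMem
    (Pr : (Fin k → Fin n → F) × (Fin n → F) → Set (Ideal (MvPolynomial (Fin k) F)))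
    (hfin : ∀ φ, LinearIndependent F φ.1 → (Pr φ).Finite) {s d B : ℕ}
    (hcard : ∀ φ, LinearIndependent F φ.1 → (Pr φ).ncard ≤ s)
    (hlow : ∀ φ, LinearIndependent F φ.1 → ∀ P ∈ Pr φ, B ≤ affineHilbert P d)
    (hs : s < Nat.card F) (hB : n * (k + 1) + 2 ≤ B) :
    ∃ f : MvPolynomial (Fin n) F, f.totalDegree ≤ d ∧
      ∀ φ, LinearIndependent F φ.1 → ∀ P ∈ Pr φ, ∀ c, affineSubst φ (f + C c) ∉ P := by
  classical
  have := Fintype.ofFinite F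
  have : Finite (restrictTotalDegree (Fin n) F d) := Module.finite_of_finite F
  have := Fintype.ofFinite (restrictTotalDegree (Fin n) F d)
  set q := Nat.card F with hq
  have hq0 : 0 < q := Nat.card_pos
  let V := restrictTotalDegree (Fin n) F d
  let Φ : Finset ((Fin k → Fin n → F) × (Fin n → F)) :=
    Finset.univ.filter fun φ => LinearIndependent F φ.1
  let T : (Fin k → Fin n → F) × (Fin n → F) → Finset (Ideal (MvPolynomial (Fin k) F)) :=
    fun φ => if h : LinearIndependent F φ.1 then (hfin φ h).toFinset else ∅
  have hT : ∀ φ, LinearIndependent F φ.1 → ∀ P, P ∈ T φ ↔ P ∈ Pr φ := fun φ h P => by simp [T, h]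
  let Z : (Fin k → Fin n → F) × (Fin n → F) → Ideal (MvPolynomial (Fin k) F) → F → Finset V :=
    fun φ P c => Finset.univ.filter fun f =>
      affineSubst φ ((f : MvPolynomial (Fin n) F) + C c) ∈ P
  let bad : Finset V := Φ.biUnion fun φ => (T φ).biUnion fun P => Finset.univ.biUnion (Z φ P)
  have hZ : ∀ φ, LinearIndependent F φ.1 → ∀ P ∈ Pr φ, ∀ c,
      (Z φ P c).card ≤ Nat.card V / q ^ B := fun φ hφ P hP c => by
    rw [Nat.le_div_iff_mul_le (by positivity), ← Set.ncard_coe_finset]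
    simpa only [Z, Finset.coe_filter, Finset.mem_univ, true_and] using
      ncard_affineSubst_mem_mul_pow_le φ hφ P c (hlow φ hφ P hP)
  have hbad : bad.card ≤ q ^ (n * (k + 1)) * (s * (q * (Nat.card V / q ^ B))) := by
    refine (Finset.card_biUnion_le_card_mul _ _ _ fun φ hφ => ?_).trans
      (Nat.mul_le_mul_right _ (?_ : Φ.card ≤ q ^ (n * (k + 1))))
    · have hφ' : LinearIndependent F φ.1 := (Finset.mem_filter.1 hφ).2
      refine (Finset.card_biUnion_le_card_mul _ _ _ fun P hP => ?_).trans
        (Nat.mul_le_mul_right _ (?_ : (T φ).card ≤ s))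
      · refine (Finset.card_biUnion_le_card_mul _ _ _ fun c _ =>
          hZ φ hφ' P ((hT φ hφ' P).1 hP) c).trans_eq ?_
        rw [Finset.card_univ, ← Nat.card_eq_fintype_card]
      · simp only [T, hφ', dif_pos]
        exact (Set.ncard_eq_toFinset_card _ (hfin φ hφ')).symm.trans_le (hcard φ hφ')
    · refine (Finset.card_le_univ _).trans_eq ?_
      rw [hq, Nat.card_eq_fintype_card]
      simp only [Fintype.card_prod, Fintype.card_fun, Fintype.card_fin]
      ring
  have hlt : bad.card < (Finset.univ : Finset V).card := by
    rw [Finset.card_univ, ← Nat.card_eq_fintype_card]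
    have hV : 0 < Nat.card V := Nat.card_pos
    refine lt_of_le_of_lt hbad ?_
    rcases Nat.eq_zero_or_pos (Nat.card V / q ^ B) with h0 | h0
    · rw [h0]
      simpa using hV
    calc q ^ (n * (k + 1)) * (s * (q * (Nat.card V / q ^ B)))
        < q ^ (n * (k + 1)) * (q * (q * (Nat.card V / q ^ B))) := by gcongr
      _ = q ^ (n * (k + 1) + 2) * (Nat.card V / q ^ B) := by ring
      _ ≤ q ^ B * (Nat.card V / q ^ B) := by gcongr
      _ ≤ Nat.card V := Nat.mul_div_le _ _
  obtain ⟨f, -, hf⟩ := Finset.exists_mem_notMem_of_card_lt_card hlt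
  refine ⟨f, (mem_restrictTotalDegree _ _ _).1 f.2, fun φ hφ P hP c hmem => hf ?_⟩
  simp only [bad, Finset.mem_biUnion]
  exact ⟨φ, by simp [Φ, hφ], P, (hT φ hφ P).2 hP, c, Finset.mem_univ _,
    Finset.mem_filter.2 ⟨Finset.mem_univ _, hmem⟩⟩

theorem exists_ncard_le_mul_ncard_zeros_add_C (S : Set (Fin n → F)) (f : MvPolynomial (Fin n) F) :
    ∃ c : F, S.ncard ≤ Nat.card F * {x ∈ S | eval x (f + C c) = 0}.ncard := by
  classical
  have := Fintype.ofFinite F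
  have hsum : S.ncard = ∑ c : F, {x ∈ S | eval x (f + C c) = 0}.ncard := by
    rw [Set.ncard_eq_toFinset_card S (Set.toFinite _),
      Finset.card_eq_sum_card_fiberwise (f := fun x => - eval x f) (t := Finset.univ)
        (fun _ _ => Finset.mem_coe.2 (Finset.mem_univ _))]
    refine Finset.sum_congr rfl fun c _ => ?_
    rw [← Set.ncard_coe_finset]
    congr 1
    ext x
    simp [neg_eq_iff_add_eq_zero]
  obtain ⟨c, -, hc⟩ := Finset.exists_le_of_sum_le (s := Finset.univ (α := F))
    (f := fun _ => S.ncard) (g := fun c => Nat.card F * {x ∈ S | eval x (f + C c) = 0}.ncard)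
    Finset.univ_nonempty (by
      rw [← Finset.mul_sum, ← hsum, Nat.card_eq_fintype_card]; simp)
  exact ⟨c, hc⟩

theorem exists_insert_sectionIdeal_growth {i : ℕ} (hi : i < k) {G : Finset (MvPolynomial (Fin n) F)}
    (hG : G.card ≤ i) {D t : ℕ} (ht : 0 < t) (htB : n * (k + 1) + 2 ≤ (t + 1) ^ (k - i))
    (hq : D * (2 * k) ^ (k - i) < Nat.card F)
    (hgrow : ∀ φ : (Fin k → Fin n → F) × (Fin n → F), LinearIndependent F φ.1 →
      ∃ m₀, ∀ m ≥ m₀, affineHilbert (sectionIdeal G φ) m ≤ D * m ^ (k - i)) :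
    ∃ G' : Finset (MvPolynomial (Fin n) F), G'.card ≤ i + 1 ∧
      {x | ∀ g ∈ G, eval x g = 0}.ncard ≤ Nat.card F * {x | ∀ g ∈ G', eval x g = 0}.ncard ∧
      ∀ φ : (Fin k → Fin n → F) × (Fin n → F), LinearIndependent F φ.1 →
        ∃ m₀, ∀ m ≥ m₀, affineHilbert (sectionIdeal G' φ) m ≤
          2 ^ (k - i + 1) * (k * t) * D * m ^ (k - (i + 1)) := by
  classical
  have hk : 0 < k := by omega
  have hfin : ∀ φ : (Fin k → Fin n → F) × (Fin n → F), (affineSubst φ '' (G : Set _)).Finite :=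
    fun φ => G.finite_toSet.image _
  have hncard : ∀ φ : (Fin k → Fin n → F) × (Fin n → F),
      (affineSubst φ '' (G : Set (MvPolynomial (Fin n) F))).ncard ≤ i := fun φ => by
    refine (Set.ncard_image_le G.finite_toSet).trans ?_
    rwa [Set.ncard_coe_finset]
  obtain ⟨f, hfd, hf⟩ := exists_forall_affineSubst_notMem (d := k * t)
    (fun φ : (Fin k → Fin n → F) × (Fin n → F) =>
      (Ideal.span (affineSubst φ '' (G : Set (MvPolynomial (Fin n) F)))).minimalPrimes)
    (fun φ _ => Ideal.finite_minimalPrimes_of_isNoetherianRing _ _)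
    (fun φ hφ => by
      obtain ⟨m₀, hm₀⟩ := hgrow φ hφ
      exact ncard_minimalPrimes_le hk (hfin φ) (hncard φ) hm₀)
    (fun φ _ P hP => by
      have := hP.1.1
      refine pow_le_affineHilbert P ?_ t
      exact (Ideal.height_le_card_of_mem_minimalPrimes_span (hfin φ) hP).trans
        (by exact_mod_cast hncard φ)) hq htB
  obtain ⟨c, hc⟩ := exists_ncard_le_mul_ncard_zeros_add_C {x | ∀ g ∈ G, eval x g = 0} f
  refine ⟨insert (f + C c) G, (Finset.card_insert_le _ _).trans (by omega), ?_, fun φ hφ => ?_⟩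
  · convert hc using 4 with x
    simp [and_comm]
  · obtain ⟨m₀, hm₀⟩ := hgrow φ hφ
    have hdeg : (affineSubst φ (f + C c)).totalDegree ≤ k * t := by
      refine (totalDegree_affineSubst_le _ _).trans ((totalDegree_add _ _).trans (max_le hfd ?_))
      simp
    have hstep := affineHilbert_growth_step (I := sectionIdeal G φ)
      (J := sectionIdeal (insert (f + C c) G) φ)
      (Ideal.radical_mono (Ideal.span_mono (Set.image_mono (by simp))))
      (Ideal.le_radical (Ideal.subset_span ⟨f + C c, by simp, rfl⟩))
      (fun p hp => mem_radical_of_mul_mem_radical (fun P hP => hf φ hφ P hP c) hp)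
      hdeg (by positivity) (a := k - (i + 1)) (D := D) (m₀ := m₀)
      (by rwa [show k - (i + 1) + 1 = k - i by omega])
    rw [show k - (i + 1) + 2 = k - i + 1 by omega] at hstep
    exact ⟨_, hstep⟩

/-- The growth constants of the successive sections, the `j`-th equation having degree `k * t j`. -/
def sectionDegree (k : ℕ) (t : ℕ → ℕ) : ℕ → ℕ
  | 0 => 2 ^ k
  | i + 1 => 2 ^ (k - i + 1) * (k * t i) * sectionDegree k t i

theorem exists_sectionIdeal_growth {t : ℕ → ℕ} (ht : ∀ i < k, 0 < t i)
    (htB : ∀ i < k, n * (k + 1) + 2 ≤ (t i + 1) ^ (k - i))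
    (hq : ∀ i < k, sectionDegree k t i * (2 * k) ^ (k - i) < Nat.card F) (i : ℕ) (hi : i ≤ k) :
    ∃ G : Finset (MvPolynomial (Fin n) F), G.card ≤ i ∧
      Nat.card F ^ n ≤ Nat.card F ^ i * {x | ∀ g ∈ G, eval x g = 0}.ncard ∧
      ∀ φ : (Fin k → Fin n → F) × (Fin n → F), LinearIndependent F φ.1 →
        ∃ m₀, ∀ m ≥ m₀, affineHilbert (sectionIdeal G φ) m ≤
          sectionDegree k t i * m ^ (k - i) := by
  induction i with
  | zero =>
    refine ⟨∅, by simp, by simp [Set.ncard_univ, Nat.card_fun], fun φ _ => ⟨1, fun m hm => ?_⟩⟩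
    refine (affineHilbert_le_pow _ m).trans ?_
    rw [sectionDegree, Nat.sub_zero, ← mul_pow]
    exact Nat.pow_le_pow_left (by omega) _
  | succ i ih =>
    obtain ⟨G, hG, hn, hgrow⟩ := ih (by omega)
    obtain ⟨G', hG', hn', hgrow'⟩ := exists_insert_sectionIdeal_growth (by omega) hG
      (ht i (by omega)) (htB i (by omega)) (hq i (by omega)) hgrow
    refine ⟨G', hG', hn.trans ?_, hgrow'⟩
    calc _ ≤ Nat.card F ^ i * (Nat.card F * {x | ∀ g ∈ G', eval x g = 0}.ncard) := by gcongr
      _ = _ := by ring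

theorem exists_evasive_set (hk : 0 < k) (hkn : k ≤ n) {t : ℕ → ℕ} (ht : ∀ i < k, 0 < t i)
    (htB : ∀ i < k, n * (k + 1) + 2 ≤ (t i + 1) ^ (k - i))
    (hq : ∀ i < k, sectionDegree k t i * (2 * k) ^ (k - i) < Nat.card F) :
    ∃ S : Set (Fin n → F), Nat.card F ^ (n - k) ≤ S.ncard ∧
      ∀ W : AffineSubspace F (Fin n → F), Module.finrank F W.direction = k →
        (S ∩ (W : Set (Fin n → F))).ncard ≤ sectionDegree k t k := by
  obtain ⟨G, -, hn, hgrow⟩ := exists_sectionIdeal_growth (F := F) ht htB hq k le_rfl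
  refine ⟨{x | ∀ g ∈ G, eval x g = 0}, ?_, fun W hW => ?_⟩
  · have e : Nat.card F ^ k * Nat.card F ^ (n - k) = Nat.card F ^ n := by
      rw [← pow_add, Nat.add_sub_cancel' hkn]
    exact Nat.le_of_mul_le_mul_left (e.trans_le hn) (pow_pos Nat.card_pos k)
  rcases Set.eq_empty_or_nonempty (W : Set (Fin n → F)) with hemp | ⟨b, hb⟩
  · simp [hemp]
  let v := Module.finBasisOfFinrankEq F W.direction hW
  let φ : (Fin k → Fin n → F) × (Fin n → F) := (fun l => v l, b)
  have hφ : LinearIndependent F φ.1 :=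
    v.linearIndependent.map' W.direction.subtype (Submodule.ker_subtype _)
  let ψ : (Fin k → F) → (Fin n → F) := fun y => φ.2 + ∑ l, y l • φ.1 l
  obtain ⟨m₀, hm₀⟩ := hgrow φ hφ
  have hsub : {x | ∀ g ∈ G, eval x g = 0} ∩ (W : Set (Fin n → F)) ⊆
      ψ '' {y | ∀ g ∈ G, eval (ψ y) g = 0} := by
    rintro x ⟨hx, hxW⟩
    have hdir : x - b ∈ W.direction := AffineSubspace.vsub_mem_direction hxW hb
    have hxψ : ψ (v.repr ⟨x - b, hdir⟩) = x := by
      have := congrArg Subtype.val (v.sum_repr ⟨x - b, hdir⟩)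
      simp only [AddSubmonoidClass.coe_finsetSum, Submodule.coe_smul] at this
      change b + ∑ l, _ • (v l : Fin n → F) = x
      rw [this, add_sub_cancel]
    exact ⟨_, fun g hg => by rw [hxψ]; exact hx g hg, hxψ⟩
  refine (Set.ncard_le_ncard hsub (Set.toFinite _)).trans
    ((Set.ncard_image_le (Set.toFinite _)).trans ?_)
  refine ncard_zeros_le hk (I := Ideal.span (affineSubst φ '' G)) (Set.toFinite _)
    (fun y hy p hp => ?_) (m₀ := m₀) (fun m hm => by simpa using! hm₀ m hm)
  have : Ideal.span (affineSubst φ '' (G : Set (MvPolynomial (Fin n) F))) ≤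
      RingHom.ker (eval y) := by
    rw [Ideal.span_le]
    rintro _ ⟨g, hg, rfl⟩
    change eval y (affineSubst φ g) = 0
    rw [eval_affineSubst]
    exact hy g hg
  exact this hp

end Construction

theorem sectionDegree_le {k : ℕ} {t : ℕ → ℕ} {x : ℝ} (hx : 0 < x)
    (ht : ∀ i < k, (t i : ℝ) ≤ (k + 4) * x ^ (1 / ((k - i : ℕ) : ℝ))) (i : ℕ) (hi : i ≤ k) :
    (sectionDegree k t i : ℝ) ≤ 2 ^ k * (2 ^ (k + 1) * k * (k + 4)) ^ i *
      x ^ (∑ j ∈ Finset.range i, 1 / ((k - j : ℕ) : ℝ)) := by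
  induction i with
  | zero => simp [sectionDegree]
  | succ i ih =>
    rw [sectionDegree, Finset.sum_range_succ, Real.rpow_add hx]
    push_cast
    calc (2 : ℝ) ^ (k - i + 1) * (k * t i) * sectionDegree k t i
        ≤ 2 ^ (k + 1) * (k * ((k + 4) * x ^ (1 / ((k - i : ℕ) : ℝ)))) *
          (2 ^ k * (2 ^ (k + 1) * k * (k + 4)) ^ i *
            x ^ (∑ j ∈ Finset.range i, 1 / ((k - j : ℕ) : ℝ))) := by
          gcongr
          · norm_num
          · omega
          · exact ht i (by omega)
          · exact ih (by omega)
      _ = _ := by ring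

theorem sum_range_one_div_sub (k : ℕ) :
    ∑ j ∈ Finset.range k, 1 / ((k - j : ℕ) : ℝ) = ∑ i ∈ Finset.range k, (1 : ℝ) / (i + 1) := by
  rw [← Finset.sum_range_reflect]
  refine Finset.sum_congr rfl fun j hj => ?_
  have : j < k := Finset.mem_range.1 hj
  rw [show k - (k - 1 - j) = j + 1 by omega]
  push_cast
  rfl

/-- The number of `(k, r)`-evasive sets is at least that of the subsets of one of them. -/
theorem two_pow_ncard_le_ncard_evasive {F : Type*} [Field F] [Finite F] {n k r : ℕ}
    {S : Set (Fin n → F)}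
    (hS : ∀ W : AffineSubspace F (Fin n → F), Module.finrank F W.direction = k →
      (S ∩ (W : Set (Fin n → F))).ncard < r) :
    2 ^ S.ncard ≤ {S : Set (Fin n → F) | ∀ W : AffineSubspace F (Fin n → F),
      Module.finrank F W.direction = k → (S ∩ (W : Set (Fin n → F))).ncard < r}.ncard := by
  rw [← Set.ncard_powerset S]
  refine Set.ncard_le_ncard (fun T hT W hW => lt_of_le_of_lt ?_ (hS W hW)) (Set.toFinite _)
  exact Set.ncard_le_ncard (Set.inter_subset_inter_left _ hT) (Set.toFinite _)

end Evasive

/-- For every integer `k ≥ 1` there exists `c > 0` such that for every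
`n ≥ k` and every integer `r ≥ c · n^(H_k)` (with `H_k = 1 + 1/2 + ⋯ + 1/k`) there exist
`δ > 0` and `q₀` such that for every prime power `q ≥ q₀` (i.e. every finite field `F` of
cardinality `q`), the number of `(k, r)`-evasive subsets of `F^n` is at least
`2 ^ (δ · q^(n-k))`. -/
theorem statement4 (k : ℕ) (hk : 1 ≤ k) :
    ∃ c : ℝ, 0 < c ∧
      ∀ n : ℕ, k ≤ n →
        ∀ r : ℕ, c * (n : ℝ) ^ (∑ i ∈ Finset.range k, (1 : ℝ) / (i + 1)) ≤ (r : ℝ) →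
          ∃ δ : ℝ, 0 < δ ∧
            ∃ q0 : ℕ, ∀ q : ℕ, q0 ≤ q → IsPrimePow q →
              ∀ (F : Type) [Field F] [Fintype F], Fintype.card F = q →
                (2 : ℝ) ^ (δ * (q : ℝ) ^ (n - k)) ≤
                  (({S : Set (Fin n → F) |
                      ∀ W : AffineSubspace F (Fin n → F),
                        Module.finrank F W.direction = k →
                          (S ∩ (W : Set (Fin n → F))).ncard < r}.ncard : ℝ)) := by
  refine ⟨2 ^ k * (2 ^ (k + 1) * k * (k + 4)) ^ k + 1, by positivity, fun n hkn r hr => ?_⟩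
  have hn : (1 : ℝ) ≤ n := by exact_mod_cast hk.trans hkn
  have hn0 : (0 : ℝ) < n := by linarith
  let t : ℕ → ℕ := fun i => ⌈((k : ℝ) + 3) * (n : ℝ) ^ (1 / ((k - i : ℕ) : ℝ))⌉₊
  have hroot : ∀ i, 1 ≤ (n : ℝ) ^ (1 / ((k - i : ℕ) : ℝ)) := fun i =>
    Real.one_le_rpow hn (by positivity)
  have ht_pos : ∀ i < k, 0 < t i := fun i _ => Nat.ceil_pos.2 (by positivity)
  have ht_le : ∀ i < k, (t i : ℝ) ≤ (k + 4) * (n : ℝ) ^ (1 / ((k - i : ℕ) : ℝ)) := fun i _ => by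
    refine (Nat.ceil_lt_add_one (by positivity)).le.trans ?_
    linarith [hroot i]
  have ht_pow : ∀ i < k, n * (k + 1) + 2 ≤ (t i + 1) ^ (k - i) := fun i hi => by
    have hki : k - i ≠ 0 := by omega
    have h : ((k : ℝ) + 3) * n ≤ (t i : ℝ) ^ (k - i) := by
      calc ((k : ℝ) + 3) * n ≤ (k + 3) ^ (k - i) * n := by
            gcongr
            exact le_self_pow₀ (by linarith [(Nat.cast_nonneg k : (0 : ℝ) ≤ k)]) hki
        _ = ((k + 3) * (n : ℝ) ^ (1 / ((k - i : ℕ) : ℝ))) ^ (k - i) := by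
            rw [mul_pow, one_div, Real.rpow_inv_natCast_pow hn0.le hki]
        _ ≤ _ := by gcongr; exact Nat.le_ceil _
    have h' : (k + 3) * n ≤ t i ^ (k - i) := by exact_mod_cast h
    have h1 : 1 ≤ n := hk.trans hkn
    have h2 : t i ^ (k - i) ≤ (t i + 1) ^ (k - i) := Nat.pow_le_pow_left (by omega) _
    nlinarith
  have hdeg : sectionDegree k t k < r := by
    have h := sectionDegree_le hn0 ht_le k le_rfl
    rw [sum_range_one_div_sub] at h
    have hH : 1 ≤ (n : ℝ) ^ (∑ i ∈ Finset.range k, (1 : ℝ) / (i + 1)) :=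
      Real.one_le_rpow hn (by positivity)
    have : (sectionDegree k t k : ℝ) < r := by linarith
    exact_mod_cast this
  refine ⟨1, one_pos,
    ∑ i ∈ Finset.range k, sectionDegree k t i * (2 * k) ^ (k - i) + 1, ?_⟩
  rintro q hq - F _ _ rfl
  rw [← Nat.card_eq_fintype_card] at hq ⊢
  obtain ⟨S, hS, hSW⟩ := exists_evasive_set (F := F) hk hkn ht_pos ht_pow fun i hi =>
    (Nat.lt_of_succ_le hq).trans_le' (Finset.single_le_sum
      (f := fun i => sectionDegree k t i * (2 * k) ^ (k - i)) (fun _ _ => Nat.zero_le _)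
      (Finset.mem_range.2 hi))
  have hcount := two_pow_ncard_le_ncard_evasive fun W hW => (hSW W hW).trans_lt hdeg
  rw [one_mul, ← Nat.cast_pow, Real.rpow_natCast]
  exact_mod_cast (Nat.pow_le_pow_right two_pos hS).trans hcount
end

section
/- For every prime power q and every set P ⊆ 𝔽_q², the number of collinear triples contained in P is at least (1/3)·|P|·(q+1)·B((|P|−1)/(q+1)), where B(x) = x(x−1)/2 denotes the generalized binomial coefficient 'x choose 2'. -/
open Classical in
/-- The slope of a plane vector, with `none` standing for the vertical direction. -/
noncomputable def slopeOption {F : Type*} [Field F] (v : Fin 2 → F) : Option F :=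
  if v 0 = 0 then none else some (v 1 / v 0)

lemma exists_eq_smul_of_slopeOption_eq {F : Type*} [Field F] {v w : Fin 2 → F} (hv : v ≠ 0)
    (h : slopeOption v = slopeOption w) : ∃ r : F, w = r • v := by
  unfold slopeOption at h
  by_cases hv0 : v 0 = 0 <;> by_cases hw0 : w 0 = 0
  · have hv1 : v 1 ≠ 0 := by
      intro h1
      apply hv
      ext i
      fin_cases i <;> simpa
    refine ⟨w 1 / v 1, ?_⟩
    ext i
    fin_cases i
    · simp [hv0, hw0]
    · simp [hv1]
  · simp [hv0, hw0] at h
  · simp [hv0, hw0] at h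
  · simp only [hv0, hw0, if_false, Option.some.injEq] at h
    refine ⟨w 0 / v 0, ?_⟩
    ext i
    fin_cases i
    · simp [hv0]
    · rw [div_eq_div_iff hv0 hw0] at h
      simp only [Pi.smul_apply, smul_eq_mul, Fin.mk_one]
      field_simp
      linear_combination -h

lemma collinear_triple_of_slopeOption_eq {F : Type*} [Field F] {x y z : Fin 2 → F} (hxy : y ≠ x)
    (h : slopeOption (y - x) = slopeOption (z - x)) : Collinear F {x, y, z} := by
  obtain ⟨r, hr⟩ := exists_eq_smul_of_slopeOption_eq (sub_ne_zero.2 hxy) h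
  rw [collinear_iff_of_mem (p₀ := x) (by simp)]
  refine ⟨y - x, ?_⟩
  simp only [Set.mem_insert_iff, Set.mem_singleton_iff, vadd_eq_add, forall_eq_or_imp, forall_eq]
  exact ⟨⟨0, by simp⟩, ⟨1, by simp⟩, ⟨r, by rw [← hr]; simp⟩⟩

/-- The number of ordered pairs of distinct elements with equal images, bounded below through the
Cauchy–Schwarz inequality. -/
lemma sq_card_div_sub_card_le_card_offDiag_filter {α β : Type*} [DecidableEq α] [DecidableEq β]
    [Fintype β] [Nonempty β] (s : Finset α) (f : α → β) :
    (s.card : ℝ) ^ 2 / Fintype.card β - s.card ≤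
      ((s.offDiag.filter fun p => f p.1 = f p.2).card : ℝ) := by
  have hβ : (0 : ℝ) < Fintype.card β := by exact_mod_cast Fintype.card_pos
  have hs : ∑ b, ((s.filter fun a => f a = b).card : ℝ) = s.card := by
    exact_mod_cast (Finset.card_eq_sum_card_fiberwise (f := f) (t := Finset.univ)
      (fun _ _ => Finset.mem_coe.2 (Finset.mem_univ _))).symm
  have hpairs : ((s.offDiag.filter fun p => f p.1 = f p.2).card : ℝ) =
      ∑ b, (((s.filter fun a => f a = b).card : ℝ) ^ 2 - (s.filter fun a => f a = b).card) := by
    rw [Finset.card_eq_sum_card_fiberwise (f := fun p => f p.1) (t := Finset.univ)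
      (fun _ _ => Finset.mem_coe.2 (Finset.mem_univ _))]
    push_cast
    refine Finset.sum_congr rfl fun b _ => ?_
    have : ((s.offDiag.filter fun p => f p.1 = f p.2).filter fun p => f p.1 = b) =
        (s.filter fun a => f a = b).offDiag := by
      ext p
      simp only [Finset.mem_filter, Finset.mem_offDiag]
      grind
    rw [this, Finset.offDiag_card, Nat.cast_sub (Nat.le_mul_self _)]
    push_cast
    ring
  rw [hpairs, Finset.sum_sub_distrib, hs]
  gcongr
  rw [div_le_iff₀ hβ, ← hs, mul_comm]
  exact_mod_cast sq_sum_le_card_mul_sum_sq (s := Finset.univ)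
    (f := fun b => ((s.filter fun a => f a = b).card : ℝ))

/-- If `T` contains every `{x, y, z}` arising from an ordered triple in `S`, then `S` has at most
six elements per element of `T`. -/
lemma card_orderedTriples_le {α : Type*} [DecidableEq α] (S : Finset (Σ _ : α, α × α))
    (T : Finset (Finset α)) (hT : ∀ t ∈ T, t.card = 3)
    (hST : ∀ p ∈ S, ({p.1, p.2.1, p.2.2} : Finset α) ∈ T) : S.card ≤ 6 * T.card := by
  refine Finset.card_le_mul_card_image_of_maps_to hST 6 fun t ht => ?_
  obtain ⟨a, b, c, hab, hac, hbc, rfl⟩ := Finset.card_eq_three.1 (hT t ht)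
  refine (Finset.card_le_card (t := {⟨a, b, c⟩, ⟨a, c, b⟩, ⟨b, a, c⟩, ⟨b, c, a⟩, ⟨c, a, b⟩,
    ⟨c, b, a⟩}) ?_).trans Finset.card_le_six
  rintro ⟨x, y, z⟩ hp
  obtain ⟨-, hp⟩ := Finset.mem_filter.1 hp
  have ha : a ∈ ({x, y, z} : Finset α) := by simp [hp]
  have hb : b ∈ ({x, y, z} : Finset α) := by simp [hp]
  have hc : c ∈ ({x, y, z} : Finset α) := by simp [hp]
  simp only [Finset.mem_insert, Finset.mem_singleton] at ha hb hc
  rcases ha with rfl | rfl | rfl <;> rcases hb with rfl | rfl | rfl <;>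
    rcases hc with rfl | rfl | rfl <;> simp_all

/-- For every prime power `q` (i.e. every finite field `F` of cardinality
`q`) and every point set `P ⊆ F²`, the number of collinear triples contained in `P` (i.e. of
3-element subsets of `P` lying on an affine line) is at least
`(1/3)·|P|·(q+1)·B((|P|-1)/(q+1))`, where `B x = x·(x-1)/2`. -/
theorem statement5 (q : ℕ) (hq : IsPrimePow q)
    (F : Type) [Field F] [Fintype F] (hF : Fintype.card F = q)
    (P : Set (Fin 2 → F)) :
    (1 : ℝ) / 3 * P.ncard * (q + 1) *
        (((P.ncard : ℝ) - 1) / (q + 1) * ((((P.ncard : ℝ) - 1) / (q + 1)) - 1) / 2) ≤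
      ({t : Finset (Fin 2 → F) |
          (t : Set (Fin 2 → F)) ⊆ P ∧ t.card = 3 ∧
            Collinear F (t : Set (Fin 2 → F))}.ncard : ℝ) := by
  classical
  obtain ⟨Q, rfl⟩ : ∃ Q : Finset (Fin 2 → F), (Q : Set (Fin 2 → F)) = P :=
    ⟨P.toFinite.toFinset, by simp⟩
  set T : Finset (Finset (Fin 2 → F)) :=
    {t ∈ Q.powerset | t.card = 3 ∧ Collinear F (t : Set (Fin 2 → F))} with hT
  have hTset : {t : Finset (Fin 2 → F) | (t : Set (Fin 2 → F)) ⊆ Q ∧ t.card = 3 ∧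
      Collinear F (t : Set (Fin 2 → F))} = T := by
    ext t
    simp [hT]
  rw [hTset, Set.ncard_coe_finset, Set.ncard_coe_finset]
  let S := Q.sigma fun x => (Q.erase x).offDiag.filter fun p =>
    slopeOption (p.1 - x) = slopeOption (p.2 - x)
  have hupper : S.card ≤ 6 * T.card := by
    refine card_orderedTriples_le S T (fun t ht => (Finset.mem_filter.1 ht).2.1) ?_
    rintro ⟨x, y, z⟩ hp
    simp only [S, Finset.mem_sigma, Finset.mem_filter, Finset.mem_offDiag,
      Finset.mem_erase] at hp
    obtain ⟨hx, ⟨⟨hyx, hy⟩, ⟨hzx, hz⟩, hyz⟩, hslope⟩ := hp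
    simp only [hT, Finset.mem_filter, Finset.mem_powerset]
    refine ⟨by simp [Finset.insert_subset_iff, hx, hy, hz],
      Finset.card_eq_three.2 ⟨x, y, z, hyx.symm, hzx.symm, hyz, rfl⟩, ?_⟩
    simpa using collinear_triple_of_slopeOption_eq hyx hslope
  have hlower : Q.card * (((Q.card : ℝ) - 1) ^ 2 / (q + 1) - (Q.card - 1)) ≤ S.card := by
    rw [Finset.card_sigma]
    push_cast
    rw [← nsmul_eq_mul]
    refine Finset.card_nsmul_le_sum _ _ _ fun x hx => ?_
    have h := sq_card_div_sub_card_le_card_offDiag_filter (Q.erase x)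
      fun y => slopeOption (y - x)
    rwa [Finset.cast_card_erase_of_mem hx, Fintype.card_option, hF, Nat.cast_succ] at h
  have hupper' : (S.card : ℝ) ≤ 6 * T.card := by exact_mod_cast hupper
  have hq1 : (q : ℝ) + 1 ≠ 0 := by positivity
  calc _ = Q.card * (((Q.card : ℝ) - 1) ^ 2 / (q + 1) - (Q.card - 1)) / 6 := by
        field_simp
        ring
    _ ≤ T.card := by linarith
end

section
/- For every ε > 0 and δ > 0 there exists q_0 such that for every prime power q ≥ q_0 and every real p with q^{−1/2+ε} ≤ p ≤ 1, with probability at least 1 − δ the p-random set S_p ⊆ 𝔽_q² contains a collinear-triple-free subset of size at least (1−δ)·p·q; that is, with high probability α(𝔽_q²,p) ≥ (1−o(1))·p·q in this range. -/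
open MeasureTheory NNReal

open ProbabilityTheory in
/-- Chebyshev lower tail bound for the number of elements of `s` in a random subset. -/
theorem measure_pi_card_filter_lt_le {ι : Type*} [Fintype ι] (μ : Measure Bool)
    [IsProbabilityMeasure μ] (s : Finset ι) {δ : ℝ} (hδ : 0 < δ)
    (hs : 1 ≤ δ ^ 3 * (s.card * μ.real {true})) :
    (Measure.pi fun _ : ι => μ)
        {ω | ((s.filter fun i => ω i = true).card : ℝ) < (1 - δ) * (s.card * μ.real {true})} ≤
      ENNReal.ofReal δ := by
  classical
  set m : ℝ := s.card * μ.real {true} with hm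
  set P := Measure.pi fun _ : ι => μ
  let f : Bool → ℝ := Set.indicator {true} 1
  let X : ι → (ι → Bool) → ℝ := fun i ω => f (ω i)
  have hm0 : 0 < m := by
    by_contra! h
    nlinarith [pow_pos hδ 3]
  have hmp (i : ι) : MeasurePreserving (Function.eval i) P μ := measurePreserving_eval _ i
  have integral_eval (i : ι) (g : Bool → ℝ) : ∫ ω, g (ω i) ∂P = ∫ b, g b ∂μ := by
    rw [← (hmp i).map_eq, integral_map (hmp i).measurable.aemeasurable
      (measurable_of_finite g).aestronglyMeasurable]
  have hf : ∫ b, f b ∂μ = μ.real {true} := integral_indicator_one (measurableSet_singleton _)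
  have hLp (i : ι) : MemLp (X i) 2 P := MemLp.of_discrete
  have hmean : ∫ ω, (∑ i ∈ s, X i) ω ∂P = m := by
    simp only [Finset.sum_apply]
    rw [integral_finsetSum _ fun i _ => (hLp i).integrable one_le_two]
    simp [X, integral_eval, hf, hm]
  have hind : iIndepFun X P := iIndepFun_pi fun i => (measurable_of_finite f).aemeasurable
  have hvar : Var[∑ i ∈ s, X i; P] ≤ m := by
    rw [IndepFun.variance_sum (fun i _ => hLp i) fun i _ j _ hij => hind.indepFun hij, hm,
      ← nsmul_eq_mul]
    refine Finset.sum_le_card_nsmul _ _ _ fun i _ => ?_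
    refine (variance_le_expectation_sq (hLp i).aestronglyMeasurable).trans_eq ?_
    rw [← hf, ← integral_eval i]
    congr 1 with ω
    cases h : ω i <;> simp [X, f, h]
  have hcard (ω : ι → Bool) : (∑ i ∈ s, X i) ω = (s.filter fun i => ω i = true).card := by
    rw [Finset.sum_apply, Finset.card_filter, Nat.cast_sum]
    refine Finset.sum_congr rfl fun i _ => ?_
    cases h : ω i <;> simp [X, f, h]
  calc P {ω | ((s.filter fun i => ω i = true).card : ℝ) < (1 - δ) * m}
      ≤ P {ω | δ * m ≤ |(∑ i ∈ s, X i) ω - ∫ ω, (∑ i ∈ s, X i) ω ∂P|} := by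
        refine measure_mono fun ω hω => ?_
        simp only [Set.mem_ofPred_eq] at hω ⊢
        rw [hmean, hcard, le_abs]
        right
        linarith
    _ ≤ ENNReal.ofReal (Var[∑ i ∈ s, X i; P] / (δ * m) ^ 2) :=
        meas_ge_le_variance_div_sq MemLp.of_discrete (by positivity)
    _ ≤ ENNReal.ofReal δ := by
        refine ENNReal.ofReal_le_ofReal ?_
        rw [div_le_iff₀ (by positivity)]
        nlinarith

/-- The parabola `y = x ^ 2` in the affine plane over a finite field. -/
def parabola (F : Type*) [Field F] [Fintype F] : Finset (Fin 2 → F) :=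
  Finset.univ.map ⟨fun a => ![a, a ^ 2], fun _ _ h => congrFun h 0⟩

theorem card_parabola (F : Type*) [Field F] [Fintype F] :
    (parabola F).card = Fintype.card F := by
  simp [parabola]

theorem not_collinear_of_subset_parabola {F : Type*} [Field F] [Fintype F]
    {t : Finset (Fin 2 → F)} (ht : t ⊆ parabola F) (hcard : t.card = 3) :
    ¬ Collinear F (t : Set (Fin 2 → F)) := by
  classical
  have hpar {x : Fin 2 → F} (hx : x ∈ parabola F) : ∃ a, x = ![a, a ^ 2] := by
    obtain ⟨a, -, rfl⟩ := Finset.mem_map.1 hx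
    exact ⟨a, rfl⟩
  obtain ⟨x, y, z, hxy, hxz, hyz, rfl⟩ := Finset.card_eq_three.1 hcard
  obtain ⟨a, rfl⟩ := hpar (ht (by simp : x ∈ _))
  obtain ⟨b, rfl⟩ := hpar (ht (by simp : y ∈ _))
  obtain ⟨c, rfl⟩ := hpar (ht (by simp : z ∈ _))
  have hab : b - a ≠ 0 := fun h => hxy (by rw [sub_eq_zero.1 h])
  have hac : c - a ≠ 0 := fun h => hxz (by rw [sub_eq_zero.1 h])
  have hbc : c - b ≠ 0 := fun h => hyz (by rw [sub_eq_zero.1 h])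
  intro h
  obtain ⟨v, hv⟩ := (collinear_iff_of_mem (p₀ := ![a, a ^ 2]) (by simp)).1 h
  obtain ⟨r, hr⟩ := hv ![b, b ^ 2] (by simp)
  obtain ⟨s, hs⟩ := hv ![c, c ^ 2] (by simp)
  have hr0 := congrFun hr 0
  have hr1 := congrFun hr 1
  have hs0 := congrFun hs 0
  have hs1 := congrFun hs 1
  simp only [vadd_eq_add, Pi.add_apply, Pi.smul_apply, smul_eq_mul, Matrix.cons_val_zero,
    Matrix.cons_val_one] at hr0 hr1 hs0 hs1
  refine mul_ne_zero (mul_ne_zero hab hac) hbc ?_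
  have key : (b - a) * (c ^ 2 - a ^ 2) = (c - a) * (b ^ 2 - a ^ 2) := by
    rw [hr1, hs1, hr0, hs0]
    ring
  linear_combination key

/-- For every `ε > 0` and `δ > 0` there exists `q₀` such that for every
prime power `q ≥ q₀` (i.e. every finite field `F` of cardinality `q`) and every `p` with
`q^(-1/2+ε) ≤ p ≤ 1`, with probability at least `1 - δ` the `p`-random subset of `F²`
contains a collinear-triple-free subset of size at least `(1-δ)·p·q`. -/
theorem statement7 (ε δ : ℝ) (hε : 0 < ε) (hδ : 0 < δ) :
    ∃ q0 : ℕ, ∀ q : ℕ, q0 ≤ q → IsPrimePow q →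
      ∀ (F : Type) [Field F] [Fintype F], Fintype.card F = q →
        ∀ (p : ℝ≥0) (hp1 : p ≤ 1),
          (q : ℝ) ^ (-(1 : ℝ) / 2 + ε) ≤ (p : ℝ) →
          1 - ENNReal.ofReal δ ≤
            (Measure.pi fun _ : Fin 2 → F =>
                (PMF.bernoulli p (by exact_mod_cast hp1)).toMeasure)
              {ω : (Fin 2 → F) → Bool |
                ∃ T : Finset (Fin 2 → F),
                  (∀ x ∈ T, ω x = true) ∧
                  (∀ t : Finset (Fin 2 → F), t ⊆ T → t.card = 3 →
                    ¬ Collinear F (t : Set (Fin 2 → F))) ∧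
                  (1 - δ) * p * q ≤ (T.card : ℝ)} := by
  refine ⟨max 1 ⌈(δ ^ 6)⁻¹⌉₊, fun q hq _ F _ _ hF p hp1 hp => ?_⟩
  have hq1 : (1 : ℝ) ≤ q := by exact_mod_cast (le_max_left _ _).trans hq
  have hqδ : (δ ^ 6)⁻¹ ≤ q :=
    (Nat.le_ceil _).trans (by exact_mod_cast (le_max_right _ _).trans hq)
  have hsqrt : Real.sqrt q ≤ q * p := by
    have h : (q : ℝ) ^ (-(1 : ℝ) / 2) ≤ p :=
      (Real.rpow_le_rpow_of_exponent_le hq1 (by linarith)).trans hp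
    calc Real.sqrt q = q * (q : ℝ) ^ (-(1 : ℝ) / 2) := by
          rw [Real.sqrt_eq_rpow, ← Real.rpow_one_add' (by positivity) (by norm_num)]
          norm_num
      _ ≤ q * p := by gcongr
  have hone : 1 ≤ δ ^ 3 * (q * p) := by
    have h : (δ ^ 3)⁻¹ ≤ Real.sqrt q := by
      refine Real.le_sqrt_of_sq_le ?_
      rwa [inv_pow, ← pow_mul]
    rw [inv_le_iff_one_le_mul₀ (by positivity)] at h
    nlinarith [pow_pos hδ 3]
  set μ := (PMF.bernoulli p (by exact_mod_cast hp1)).toMeasure with hμ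
  have hreal : μ.real {true} = p := by
    simp [hμ, Measure.real, PMF.bernoulli_apply]
  have htail := measure_pi_card_filter_lt_le μ (parabola F) hδ
    (by rwa [card_parabola, hF, hreal])
  rw [card_parabola, hF, hreal] at htail
  rw [tsub_le_iff_left]
  set B := {ω : (Fin 2 → F) → Bool |
    (((parabola F).filter fun i => ω i = true).card : ℝ) < (1 - δ) * (q * p)}
  calc (1 : ENNReal) = (Measure.pi fun _ : Fin 2 → F => μ) Set.univ := measure_univ.symm
    _ ≤ (Measure.pi fun _ : Fin 2 → F => μ) (B ∪ Bᶜ) := by rw [Set.union_compl_self]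
    _ ≤ _ := measure_union_le _ _
    _ ≤ _ := by
      refine add_le_add htail (measure_mono fun ω hω => ?_)
      refine ⟨(parabola F).filter fun i => ω i = true, fun x hx => (Finset.mem_filter.1 hx).2,
        fun t ht hcard => not_collinear_of_subset_parabola (ht.trans (Finset.filter_subset _ _))
          hcard, ?_⟩
      have h : (1 - δ) * (q * p) ≤ (((parabola F).filter fun i => ω i = true).card : ℝ) :=
        not_lt.1 hω
      linarith
end

section
/- For every ε > 0 there exist c > 0 and q_0 such that for every prime power q ≥ q_0 and every real p with q^{−2+ε} ≤ p ≤ q^{−3/2−ε}, with probability at least 1 − ε one has c·p·q² ≤ α(𝔽_q²,p) ≤ 2·p·q²; that is, in this range α(𝔽_q²,p) = Θ(p·q²) with high probability. -/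
open MeasureTheory NNReal

/-- The number of indices selected by `ω`. -/
noncomputable def selectedCount {ι : Type*} [Fintype ι] (ω : ι → Bool) : ℝ :=
  ∑ x, if ω x = true then 1 else 0

theorem selectedCount_eq_card {ι : Type*} [Fintype ι] (ω : ι → Bool) :
    selectedCount ω = ((Finset.univ.filter fun x => ω x = true).card : ℝ) := by
  simp [selectedCount]

section RandomSubset

variable {ι : Type*} [Fintype ι] (ν : Measure Bool) [IsProbabilityMeasure ν]

theorem pi_real_forall_eq_true (s : Finset ι) :
    (Measure.pi fun _ : ι => ν).real {ω | ∀ x ∈ s, ω x = true} = ν.real {true} ^ s.card := by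
  classical
  have h : {ω : ι → Bool | ∀ x ∈ s, ω x = true} =
      Set.pi Set.univ (fun x => if x ∈ s then {true} else Set.univ) := by
    ext ω
    simp only [Set.mem_ofPred_eq, Set.mem_pi, Set.mem_univ, true_implies]
    refine forall_congr' fun x => ?_
    by_cases hx : x ∈ s <;> simp [hx]
  rw [h, measureReal_def, Measure.pi_pi, ENNReal.toReal_prod]
  have h2 : ∀ x, (ν (if x ∈ s then {true} else Set.univ)).toReal =
      if x ∈ s then ν.real {true} else 1 := by
    intro x
    split_ifs
    · rfl
    · rw [measure_univ, ENNReal.toReal_one]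
  simp_rw [h2]
  simp

theorem integral_ite_forall_eq_true (s : Finset ι) :
    ∫ ω, (if ∀ x ∈ s, ω x = true then (1 : ℝ) else 0) ∂(Measure.pi fun _ : ι => ν) =
      ν.real {true} ^ s.card := by
  rw [← pi_real_forall_eq_true, ← integral_indicator_one (Set.toFinite _).measurableSet]
  refine integral_congr_ae (Filter.Eventually.of_forall fun ω => ?_)
  simp [Set.indicator_apply]

theorem integral_selectedCount :
    ∫ ω, selectedCount ω ∂(Measure.pi fun _ : ι => ν) = Fintype.card ι * ν.real {true} := by
  unfold selectedCount
  rw [integral_finsetSum _ fun _ _ => Integrable.of_finite]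
  have h : ∀ x : ι, ∫ ω, (if ω x = true then (1 : ℝ) else 0) ∂(Measure.pi fun _ : ι => ν) =
      ν.real {true} := fun x => by
    simpa using integral_ite_forall_eq_true ν {x}
  simp [h]

theorem integral_selectedCount_sq_le :
    ∫ ω, selectedCount ω ^ 2 ∂(Measure.pi fun _ : ι => ν) ≤
      (Fintype.card ι * ν.real {true}) ^ 2 + Fintype.card ι * ν.real {true} := by
  classical
  have h0 : ∀ ω : ι → Bool, selectedCount ω ^ 2 =
      ∑ x, ∑ y, if ∀ z ∈ ({x, y} : Finset ι), ω z = true then (1 : ℝ) else 0 := by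
    intro ω
    rw [sq, selectedCount, Finset.sum_mul_sum]
    refine Finset.sum_congr rfl fun x _ => Finset.sum_congr rfl fun y _ => ?_
    by_cases hx : ω x = true <;> by_cases hy : ω y = true <;> simp [hx, hy]
  simp_rw [h0]
  rw [integral_finsetSum _ fun _ _ => Integrable.of_finite]
  have hp : 0 ≤ ν.real {true} := measureReal_nonneg
  have h1 : ∀ x : ι, ∫ ω, (∑ y, if ∀ z ∈ ({x, y} : Finset ι), ω z = true then (1 : ℝ) else 0)
      ∂(Measure.pi fun _ : ι => ν) ≤
      Fintype.card ι * ν.real {true} ^ 2 + ν.real {true} := by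
    intro x
    rw [integral_finsetSum _ fun _ _ => Integrable.of_finite]
    calc _ ≤ ∑ y : ι, (ν.real {true} ^ 2 + if x = y then ν.real {true} else 0) := by
          refine Finset.sum_le_sum fun y _ => ?_
          refine (le_of_eq (b := ν.real {true} ^ ({x, y} : Finset ι).card) ?_).trans ?_
          · convert integral_ite_forall_eq_true ν {x, y}
          by_cases hxy : x = y
          · subst hxy
            simp
          · simp [hxy]
      _ = _ := by simp [Finset.sum_add_distrib]
  calc _ ≤ ∑ _x : ι, (Fintype.card ι * ν.real {true} ^ 2 + ν.real {true}) :=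
        Finset.sum_le_sum fun x _ => h1 x
    _ = _ := by simp; ring

theorem measureReal_abs_selectedCount_sub_ge_le (m : ℝ)
    (hm : m = Fintype.card ι * ν.real {true}) (hm0 : 0 < m) :
    (Measure.pi fun _ : ι => ν).real {ω | m / 2 ≤ |selectedCount ω - m|} ≤ 4 / m := by
  have h1 : ∫ ω, (selectedCount ω - m) ^ 2 ∂(Measure.pi fun _ : ι => ν) ≤ m := by
    have h2 : ∀ ω : ι → Bool, (selectedCount ω - m) ^ 2 =
        selectedCount ω ^ 2 - 2 * m * selectedCount ω + m ^ 2 := fun ω => by ring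
    simp_rw [h2]
    rw [integral_add Integrable.of_finite Integrable.of_finite,
      integral_sub Integrable.of_finite Integrable.of_finite, integral_const_mul,
      integral_selectedCount, ← hm]
    have h3 := integral_selectedCount_sq_le (ι := ι) ν
    rw [← hm] at h3
    simp only [integral_const, probReal_univ, one_smul]
    linarith
  have h4 := mul_meas_ge_le_integral_of_nonneg
    (μ := Measure.pi fun _ : ι => ν) (f := fun ω => (selectedCount ω - m) ^ 2)
    (Filter.Eventually.of_forall fun ω => sq_nonneg _) Integrable.of_finite ((m / 2) ^ 2)
  have h5 : {ω : ι → Bool | m / 2 ≤ |selectedCount ω - m|} ⊆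
      {ω | (m / 2) ^ 2 ≤ (selectedCount ω - m) ^ 2} := by
    intro ω hω
    simp only [Set.mem_ofPred_eq] at hω ⊢
    rw [← sq_abs (selectedCount ω - m)]
    gcongr
  have h6 := measureReal_mono (μ := Measure.pi fun _ : ι => ν) h5
  rw [le_div_iff₀ hm0]
  have h7 := mul_le_mul_of_nonneg_left h6 (sq_nonneg (m / 2))
  have h8 := h7.trans (h4.trans h1)
  have h9 : m * (m * (Measure.pi fun _ : ι => ν).real
      {ω | m / 2 ≤ |selectedCount ω - m|}) ≤ m * 4 := by linarith
  have := le_of_mul_le_mul_left h9 hm0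
  linarith

end RandomSubset

section Collinear

variable {F V : Type*} [Field F] [AddCommGroup V] [Module F V]

/-- A triple `(x, y, r)` encoding three distinct collinear points `x`, `y` and
`AffineMap.lineMap x y r`. -/
def IsCollinearCode (t : V × V × F) : Prop :=
  t.1 ≠ t.2.1 ∧ t.1 ≠ AffineMap.lineMap t.1 t.2.1 t.2.2 ∧
    t.2.1 ≠ AffineMap.lineMap t.1 t.2.1 t.2.2

open Classical in
/-- The three points encoded by a triple `(x, y, r)`. -/
noncomputable def codePoints (t : V × V × F) : Finset V :=
  {t.1, t.2.1, AffineMap.lineMap t.1 t.2.1 t.2.2}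

theorem IsCollinearCode.card_codePoints {t : V × V × F} (h : IsCollinearCode t) :
    (codePoints t).card = 3 := by
  classical
  unfold codePoints
  rw [Finset.card_eq_three]
  exact ⟨_, _, _, h.1, h.2.1, h.2.2, by congr⟩

theorem exists_isCollinearCode {t : Finset V} (ht : t.card = 3)
    (hc : Collinear F (t : Set V)) :
    ∃ a : V × V × F, IsCollinearCode a ∧ a.1 ∈ t ∧ codePoints a ⊆ t := by
  classical
  obtain ⟨x, y, z, hxy, hxz, hyz, rfl⟩ := Finset.card_eq_three.1 ht
  have hc' : Collinear F ({x, y, z} : Set V) := by simpa using hc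
  have hz := hc'.mem_affineSpan_of_mem_of_ne (p₁ := x) (p₂ := y) (p₃ := z)
    (by simp) (by simp) (by simp) hxy
  obtain ⟨r, rfl⟩ := mem_affineSpan_pair_iff_exists_lineMap_eq.1 hz
  refine ⟨(x, y, r), ⟨hxy, hxz, hyz⟩, by simp, ?_⟩
  intro w hw
  simpa [codePoints] using hw

variable [Fintype F] [Fintype V]

open Classical in
/-- The codes of distinct collinear triples all of whose points are selected by `ω`. -/
noncomputable def selectedCodes (F : Type*) {V : Type*} [Field F] [AddCommGroup V] [Module F V]
    [Fintype F] [Fintype V] (ω : V → Bool) : Finset (V × V × F) :=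
  Finset.univ.filter fun t => IsCollinearCode t ∧ ∀ x ∈ codePoints t, ω x = true

theorem integral_card_selectedCodes_le (ν : Measure Bool) [IsProbabilityMeasure ν] :
    ∫ ω, ((selectedCodes F ω).card : ℝ) ∂(Measure.pi fun _ : V => ν) ≤
      Fintype.card V ^ 2 * Fintype.card F * ν.real {true} ^ 3 := by
  classical
  have h : ∀ ω : V → Bool, ((selectedCodes F ω).card : ℝ) =
      ∑ t ∈ Finset.univ.filter (fun t : V × V × F => IsCollinearCode t),
        if ∀ x ∈ codePoints t, ω x = true then (1 : ℝ) else 0 := by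
    intro ω
    rw [Finset.sum_boole, Finset.filter_filter]
    congr!
  simp_rw [h]
  rw [integral_finsetSum _ fun _ _ => Integrable.of_finite]
  have hp : 0 ≤ ν.real {true} := measureReal_nonneg
  calc _ = ∑ t ∈ Finset.univ.filter (fun t : V × V × F => IsCollinearCode t),
          ν.real {true} ^ 3 := by
        refine Finset.sum_congr rfl fun t ht => ?_
        rw [← (Finset.mem_filter.1 ht).2.card_codePoints]
        convert integral_ite_forall_eq_true ν (codePoints t)
    _ ≤ ∑ _t : V × V × F, ν.real {true} ^ 3 :=
        Finset.sum_le_sum_of_subset_of_nonneg (Finset.filter_subset _ _)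
          fun _ _ _ => by positivity
    _ = _ := by
          rw [Finset.sum_const, Finset.card_univ, Fintype.card_prod, Fintype.card_prod, nsmul_eq_mul]
          push_cast
          ring

theorem measureReal_le_card_selectedCodes_le (ν : Measure Bool) [IsProbabilityMeasure ν]
    {a : ℝ} (ha : 0 < a) :
    (Measure.pi fun _ : V => ν).real {ω | a ≤ ((selectedCodes F ω).card : ℝ)} ≤
      Fintype.card V ^ 2 * Fintype.card F * ν.real {true} ^ 3 / a := by
  rw [le_div_iff₀ ha, mul_comm]
  exact (mul_meas_ge_le_integral_of_nonneg
    (Filter.Eventually.of_forall fun ω => Nat.cast_nonneg _) Integrable.of_finite a).trans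
    (integral_card_selectedCodes_le ν)

/-- Deleting one point from every selected collinear triple leaves a large set without
collinear triples. -/
theorem exists_collinear_free (ω : V → Bool) :
    ∃ T : Finset V, (∀ x ∈ T, ω x = true) ∧
      (∀ t : Finset V, t ⊆ T → t.card = 3 → ¬ Collinear F (t : Set V)) ∧
      selectedCount ω - (selectedCodes F ω).card ≤ (T.card : ℝ) := by
  classical
  refine ⟨(Finset.univ.filter fun x => ω x = true) \ (selectedCodes F ω).image Prod.fst,
    fun x hx => by simpa using (Finset.mem_sdiff.1 hx).1, ?_, ?_⟩
  · intro t ht h3 hc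
    obtain ⟨a, ha, ha1, ha2⟩ := exists_isCollinearCode h3 hc
    refine (Finset.mem_sdiff.1 (ht ha1)).2 (Finset.mem_image_of_mem _ ?_)
    simp only [selectedCodes, Finset.mem_filter, Finset.mem_univ, true_and]
    exact ⟨ha, fun x hx => by simpa using (Finset.mem_sdiff.1 (ht (ha2 hx))).1⟩
  · rw [selectedCount_eq_card, sub_le_iff_le_add]
    have h1 := Finset.card_le_card_sdiff_add_card
      (t := (selectedCodes F ω).image Prod.fst)
      (s := Finset.univ.filter fun x => ω x = true)
    have h2 : ((selectedCodes F ω).image Prod.fst).card ≤ (selectedCodes F ω).card :=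
      Finset.card_image_le
    exact_mod_cast h1.trans (Nat.add_le_add_left h2 _)

end Collinear

/-- For every `ε > 0` there exist `c > 0` and `q₀` such that for every prime
power `q ≥ q₀` (i.e. every finite field `F` of cardinality `q`) and every `p` with
`q^(-2+ε) ≤ p ≤ q^(-3/2-ε)`, with probability at least `1 - ε` the maximum size `α` of a
collinear-triple-free subset of the `p`-random subset of `F²` satisfies
`c·p·q² ≤ α ≤ 2·p·q²`: some collinear-triple-free subset of the random set has size at least
`c·p·q²`, and every collinear-triple-free subset of the random set has size at most
`2·p·q²`. -/
theorem statement8 (ε : ℝ) (hε : 0 < ε) :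
    ∃ c : ℝ, 0 < c ∧
      ∃ q0 : ℕ, ∀ q : ℕ, q0 ≤ q → IsPrimePow q →
        ∀ (F : Type) [Field F] [Fintype F], Fintype.card F = q →
          ∀ (p : ℝ≥0) (hp1 : p ≤ 1),
            (q : ℝ) ^ (-(2 : ℝ) + ε) ≤ (p : ℝ) →
            (p : ℝ) ≤ (q : ℝ) ^ (-(3 : ℝ) / 2 - ε) →
            1 - ENNReal.ofReal ε ≤
              (Measure.pi fun _ : Fin 2 → F =>
                  (PMF.bernoulli p (by exact_mod_cast hp1)).toMeasure)
                {ω : (Fin 2 → F) → Bool |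
                  (∃ T : Finset (Fin 2 → F),
                    (∀ x ∈ T, ω x = true) ∧
                    (∀ t : Finset (Fin 2 → F), t ⊆ T → t.card = 3 →
                      ¬ Collinear F (t : Set (Fin 2 → F))) ∧
                    c * p * (q : ℝ) ^ 2 ≤ (T.card : ℝ)) ∧
                  (∀ T : Finset (Fin 2 → F),
                    (∀ x ∈ T, ω x = true) →
                    (∀ t : Finset (Fin 2 → F), t ⊆ T → t.card = 3 →
                      ¬ Collinear F (t : Set (Fin 2 → F))) →
                    (T.card : ℝ) ≤ 2 * p * (q : ℝ) ^ 2)} := by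
  obtain ⟨R, hR⟩ := Filter.eventually_atTop.1
    (((_root_.tendsto_rpow_atTop hε).comp tendsto_natCast_atTop_atTop).eventually_ge_atTop
      (max (8 / ε) 1))
  refine ⟨1 / 4, by norm_num, max R 1, ?_⟩
  intro q hq _ F _ _ hF p hp1 hlow hup
  have hqR := hR q (le_trans (le_max_left _ _) hq)
  have hq0 : (0 : ℝ) < q := by exact_mod_cast le_trans (le_max_right _ _) hq
  obtain ⟨hqε, hqε1⟩ : 8 / ε ≤ (q : ℝ) ^ ε ∧ 1 ≤ (q : ℝ) ^ ε := max_le_iff.1 hqR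
  set ν : Measure Bool := (PMF.bernoulli p (by exact_mod_cast hp1)).toMeasure with hν
  have hνp : ν.real {true} = p := by
    rw [hν, measureReal_def, PMF.toMeasure_apply_singleton _ _ (MeasurableSet.singleton _)]
    simp [PMF.bernoulli]
  have hcard : (Fintype.card (Fin 2 → F) : ℝ) = (q : ℝ) ^ 2 := by
    simp [hF]
  have hlow' : (q : ℝ) ^ ε ≤ p * (q : ℝ) ^ 2 := by
    calc (q : ℝ) ^ ε = (q : ℝ) ^ (-(2 : ℝ) + ε) * (q : ℝ) ^ 2 := by
          rw [← Real.rpow_natCast, ← Real.rpow_add hq0]; congr 1; push_cast; ring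
      _ ≤ _ := by gcongr
  have hup' : (p : ℝ) ^ 2 * (q : ℝ) ^ 3 * (q : ℝ) ^ ε ≤ 1 := by
    have h1 : (p : ℝ) ^ 2 * (q : ℝ) ^ 3 * ((q : ℝ) ^ ε * (q : ℝ) ^ ε) ≤ 1 := by
      calc _ ≤ ((q : ℝ) ^ (-(3 : ℝ) / 2 - ε)) ^ 2 * (q : ℝ) ^ 3 *
            ((q : ℝ) ^ ε * (q : ℝ) ^ ε) := by gcongr
        _ = 1 := by
            rw [← Real.rpow_natCast _ 2, ← Real.rpow_natCast _ 3, ← Real.rpow_mul hq0.le,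
              ← Real.rpow_add hq0, ← Real.rpow_add hq0, ← Real.rpow_add hq0]
            convert Real.rpow_zero (q : ℝ) using 2
            push_cast; ring
    refine le_trans ?_ h1
    gcongr
    exact le_mul_of_one_le_left (by positivity) hqε1
  set m : ℝ := p * (q : ℝ) ^ 2 with hm
  have hm0 : 0 < m := by linarith
  have hA := measureReal_abs_selectedCount_sub_ge_le (ι := Fin 2 → F) ν m
    (by rw [hνp, hcard, hm]; ring) hm0
  have hB := measureReal_le_card_selectedCodes_le (F := F) (V := Fin 2 → F) ν
    (a := m / 4) (by positivity)
  set P : Measure ((Fin 2 → F) → Bool) := Measure.pi fun _ : Fin 2 → F => ν with hP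
  set A : Set ((Fin 2 → F) → Bool) := {ω | m / 2 ≤ |selectedCount ω - m|} with hAdef
  set B : Set ((Fin 2 → F) → Bool) := {ω | m / 4 ≤ ((selectedCodes F ω).card : ℝ)} with hBdef
  have hε8 : 8 ≤ (q : ℝ) ^ ε * ε := (div_le_iff₀ hε).1 hqε
  have hA' : P.real A ≤ ε / 2 := by
    refine hA.trans ?_
    rw [div_le_iff₀ hm0]
    have := mul_le_mul_of_nonneg_right hlow' hε.le
    linarith
  have hB' : P.real B ≤ ε / 2 := by
    refine hB.trans ?_
    rw [hνp, hcard, hF, div_le_iff₀ (by positivity)]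
    have h1 : (p : ℝ) ^ 2 * (q : ℝ) ^ 3 ≤ ε / 8 := by
      have h2 : 0 ≤ (p : ℝ) ^ 2 * (q : ℝ) ^ 3 := by positivity
      have h3 := mul_le_mul_of_nonneg_left hε8 h2
      have h4 := mul_le_mul_of_nonneg_right hup' hε.le
      linarith
    have h5 := mul_le_mul_of_nonneg_left h1 hm0.le
    calc ((q : ℝ) ^ 2) ^ 2 * q * (p : ℝ) ^ 3 = m * ((p : ℝ) ^ 2 * (q : ℝ) ^ 3) := by
          rw [hm]; ring
      _ ≤ _ := by linarith
  have hAB : P.real (A ∪ B)ᶜ ≥ 1 - ε := by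
    rw [probReal_compl_eq_one_sub (Set.toFinite _).measurableSet]
    have := measureReal_union_le (μ := P) A B
    linarith
  have hle : 1 - ENNReal.ofReal ε ≤ P (A ∪ B)ᶜ := by
    rw [← ofReal_measureReal (μ := P), ← ENNReal.ofReal_one, ← ENNReal.ofReal_sub _ hε.le]
    exact ENNReal.ofReal_le_ofReal hAB
  refine hle.trans (measure_mono fun ω hω => ?_)
  simp only [hAdef, hBdef, Set.mem_compl_iff, Set.mem_union, Set.mem_ofPred_eq, not_or, not_le,
    abs_lt] at hω
  obtain ⟨⟨hω1, hω2⟩, hω3⟩ := hω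
  refine ⟨?_, fun T hT _ => ?_⟩
  · obtain ⟨T, hT1, hT2, hT3⟩ := exists_collinear_free (F := F) ω
    exact ⟨T, hT1, hT2, by linarith⟩
  · have h1 : T ⊆ Finset.univ.filter fun x => ω x = true := fun x hx => by simpa using hT x hx
    have h2 : (T.card : ℝ) ≤ selectedCount ω := by
      rw [selectedCount_eq_card]
      exact_mod_cast Finset.card_le_card h1
    linarith
end

section
/- For all integers 1 ≤ k < n, every integer r > k, and every real c > 0, there exists θ > 0 such that the following holds for all sufficiently large prime powers q. If P ⊆ 𝔽_q^n satisfies |P| ≥ θ·q^{n−k} and |P ∩ W| ≤ 2|P|/√q for every k-dimensional affine subspace W of 𝔽_q^n, then there exists a nonempty family E of (k,r)-sets contained in P such that, setting τ = θ·q^{n−k}/(|P|·q^{1/(2r)}): (i) for every i with 2 ≤ i ≤ r, every i-element subset of P is contained in at most c·τ^{i−1}·|E|/|P| members of E, and (ii) every point of P lies in at most θ·|E|/|P| members of E. -/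
section
open scoped Classical

/-- Every subfamily of `I` of size at most `d` is linearly independent under `φ`. -/
def IndepUpTo (F : Type*) {V α : Type*} [Field F] [AddCommGroup V] [Module F V]
    (φ : α → V) (d : ℕ) (I : Finset α) : Prop :=
  ∀ J ⊆ I, J.card ≤ d → LinearIndepOn F φ (J : Set α)

variable {F V α : Type*} [Field F] [AddCommGroup V] [Module F V] {φ : α → V}

theorem IndepUpTo.mono {d : ℕ} {I J : Finset α} (h : IndepUpTo F φ d J) (hIJ : I ⊆ J) :
    IndepUpTo F φ d I :=
  fun K hK hd => h K (hK.trans hIJ) hd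

theorem IndepUpTo.empty (d : ℕ) : IndepUpTo F φ d ∅ := by
  intro J hJ _
  rw [Finset.subset_empty.mp hJ]
  simp

theorem IndepUpTo.insert_of_notMem_span {d : ℕ} {I : Finset α} {x : α} (h : IndepUpTo F φ d I)
    (hx : ∀ J ⊆ I, J.card < d → φ x ∉ Submodule.span F (φ '' (J : Set α))) :
    IndepUpTo F φ d (insert x I) := by
  intro J hJ hd
  by_cases hxJ : x ∈ J
  · have hsub : J.erase x ⊆ I := Finset.subset_insert_iff.mp hJ
    have hcard : (J.erase x).card < d := by
      have := Finset.card_erase_lt_of_mem hxJ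
      omega
    have := (h _ hsub hcard.le).insert (hx _ hsub hcard)
    rwa [← Finset.coe_insert, Finset.insert_erase hxJ] at this
  · exact h J ((Finset.subset_insert_iff_of_notMem hxJ).mp hJ) hd

theorem IndepUpTo.card_extensions {d r : ℕ} (hd : 2 ≤ d) {T I : Finset α}
    (hT : ∀ J ⊆ T, J.card < d →
      2 ^ (r + 1) * (T.filter fun x => φ x ∈ Submodule.span F (φ '' (J : Set α))).card ≤ T.card)
    (hI : IndepUpTo F φ d I) (hIT : I ⊆ T) (hr : I.card ≤ r) :
    T.card ≤ 2 * (T.filter fun x => x ∉ I ∧ IndepUpTo F φ d (insert x I)).card := by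
  set B := (I.powerset.filter fun J => J.card < d).biUnion
    fun J => T.filter fun x => φ x ∈ Submodule.span F (φ '' (J : Set α)) with hB
  have hBcard : 2 ^ (r + 1) * B.card ≤ 2 ^ r * T.card := by
    calc 2 ^ (r + 1) * B.card
        ≤ 2 ^ (r + 1) * ∑ J ∈ I.powerset.filter fun J => J.card < d,
            (T.filter fun x => φ x ∈ Submodule.span F (φ '' (J : Set α))).card := by
          gcongr
          exact Finset.card_biUnion_le
      _ ≤ ∑ J ∈ I.powerset.filter fun J => J.card < d, T.card := by
          rw [Finset.mul_sum]
          refine Finset.sum_le_sum fun J hJ => ?_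
          simp only [Finset.mem_filter, Finset.mem_powerset] at hJ
          exact hT J (hJ.1.trans hIT) hJ.2
      _ ≤ 2 ^ r * T.card := by
          rw [Finset.sum_const, smul_eq_mul]
          gcongr
          calc _ ≤ I.powerset.card := Finset.card_filter_le _ _
            _ = 2 ^ I.card := Finset.card_powerset I
            _ ≤ 2 ^ r := Nat.pow_le_pow_right (by norm_num) hr
  have hB2 : 2 * B.card ≤ T.card := by
    have : 2 ^ r * (2 * B.card) ≤ 2 ^ r * T.card := by
      calc _ = 2 ^ (r + 1) * B.card := by ring
        _ ≤ _ := hBcard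
    exact Nat.le_of_mul_le_mul_left this (by positivity)
  have hsub : T \ B ⊆ T.filter fun x => x ∉ I ∧ IndepUpTo F φ d (insert x I) := by
    intro x hx
    simp only [hB, Finset.mem_sdiff, Finset.mem_biUnion, Finset.mem_filter, Finset.mem_powerset,
      not_exists, not_and] at hx
    obtain ⟨hxT, hx⟩ := hx
    refine Finset.mem_filter.mpr ⟨hxT, fun hxI => ?_, hI.insert_of_notMem_span fun J hJ hJd => ?_⟩
    · refine hx {x} ⟨by simpa using hxI, by simp; omega⟩ hxT ?_
      exact Submodule.subset_span ⟨x, by simp, rfl⟩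
    · exact hx J ⟨hJ, hJd⟩ hxT
  have h1 := Finset.card_le_card hsub
  have h2 := Finset.le_card_sdiff B T
  omega

theorem IndepUpTo.card_supersets {d r : ℕ} (hd : 2 ≤ d) {T I : Finset α}
    (hT : ∀ J ⊆ T, J.card < d →
      2 ^ (r + 1) * (T.filter fun x => φ x ∈ Submodule.span F (φ '' (J : Set α))).card ≤ T.card)
    (hI : IndepUpTo F φ d I) (hIT : I ⊆ T) {l : ℕ} (hl : I.card ≤ l) (hlr : l ≤ r) :
    T.card ^ (l - I.card) ≤ (2 * r) ^ (l - I.card) *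
      ((T.powersetCard l).filter fun J => I ⊆ J ∧ IndepUpTo F φ d J).card := by
  induction l, hl using Nat.le_induction with
  | base =>
    simp only [Nat.sub_self, pow_zero, one_mul]
    refine Finset.card_pos.mpr ⟨I, ?_⟩
    simp [hIT, hI]
  | succ l hl ih =>
    specialize ih (by omega)
    set N := fun l => (T.powersetCard l).filter fun J => I ⊆ J ∧ IndepUpTo F φ d J with hN
    have key : (N l).card * ((T.card + 1) / 2) ≤ (N (l + 1)).card * (l + 1) := by
      refine Finset.card_mul_le_card_mul (fun J K : Finset α => J ⊆ K) ?_ ?_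
      · intro J hJ
        simp only [hN, Finset.mem_filter, Finset.mem_powersetCard] at hJ
        obtain ⟨⟨hJT, hJl⟩, hIJ, hJ⟩ := hJ
        have h1 := hJ.card_extensions hd hT hJT (by omega)
        have h2 : (T.filter fun x => x ∉ J ∧ IndepUpTo F φ d (insert x J)).card ≤
            ((N (l + 1)).bipartiteAbove (fun J K : Finset α => J ⊆ K) J).card := by
          refine Finset.card_le_card_of_injOn (fun x => insert x J) ?_ ?_
          · intro x hx
            simp only [Finset.coe_filter, Set.mem_ofPred_eq] at hx
            simp only [hN, Finset.bipartiteAbove, Finset.coe_filter, Finset.mem_filter,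
              Finset.mem_powersetCard, Set.mem_ofPred_eq]
            refine ⟨⟨⟨Finset.insert_subset hx.1 hJT, ?_⟩, ?_, hx.2.2⟩, Finset.subset_insert _ _⟩
            · rw [Finset.card_insert_of_notMem hx.2.1, hJl]
            · exact hIJ.trans (Finset.subset_insert _ _)
          · intro x hx y hy hxy
            simp only [Finset.coe_filter, Set.mem_ofPred_eq] at hx hy
            have : x ∈ insert y J := by
              rw [← show insert x J = insert y J from hxy]
              exact Finset.mem_insert_self _ _
            exact (Finset.mem_insert.mp this).resolve_right hx.2.1
        omega
      · intro K hK
        simp only [hN, Finset.mem_filter, Finset.mem_powersetCard] at hK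
        calc _ ≤ (K.powersetCard l).card := by
              refine Finset.card_le_card fun J hJ => ?_
              simp only [hN, Finset.bipartiteBelow, Finset.mem_filter,
                Finset.mem_powersetCard] at hJ ⊢
              exact ⟨hJ.2, hJ.1.1.2⟩
          _ = l + 1 := by
              rw [Finset.card_powersetCard, hK.1.2, Nat.choose_succ_self_right]
    have hstep : (N l).card * T.card ≤ (2 * r) * (N (l + 1)).card := by
      calc (N l).card * T.card ≤ (N l).card * (2 * ((T.card + 1) / 2)) := by gcongr; omega
        _ = 2 * ((N l).card * ((T.card + 1) / 2)) := by ring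
        _ ≤ 2 * ((N (l + 1)).card * (l + 1)) := by gcongr
        _ ≤ 2 * ((N (l + 1)).card * r) := by gcongr
        _ = _ := by ring
    rw [Nat.sub_add_comm hl, pow_succ, pow_succ]
    calc T.card ^ (l - I.card) * T.card
        ≤ ((2 * r) ^ (l - I.card) * (N l).card) * T.card := by gcongr
      _ = (2 * r) ^ (l - I.card) * ((N l).card * T.card) := by ring
      _ ≤ (2 * r) ^ (l - I.card) * ((2 * r) * (N (l + 1)).card) := by gcongr
      _ = _ := by ring

theorem IndepUpTo.span_eq {d : ℕ} {J : Finset α} (hJ : IndepUpTo F φ d J) (hd : d ≤ J.card)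
    {U : Submodule F V} [FiniteDimensional F U] (hU : Module.finrank F U = d)
    (hJU : ∀ x ∈ J, φ x ∈ U) :
    U = Submodule.span F (φ '' (J : Set α)) := by
  obtain ⟨K, hKJ, hK⟩ := Finset.exists_subset_card_eq hd
  have hind := hJ K hKJ hK.le
  have hle : Submodule.span F (φ '' (K : Set α)) ≤ Submodule.span F (φ '' (J : Set α)) :=
    Submodule.span_mono (Set.image_mono (by exact_mod_cast hKJ))
  have hle' : Submodule.span F (φ '' (J : Set α)) ≤ U := by
    rw [Submodule.span_le]
    rintro _ ⟨x, hx, rfl⟩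
    exact hJU x hx
  have hfin : Module.finrank F (Submodule.span F (φ '' (K : Set α))) = d := by
    have := finrank_span_eq_card hind
    rw [← Set.image_eq_range] at this
    rw [this]
    simpa using hK
  exact le_antisymm
    ((Submodule.eq_of_le_of_finrank_eq (hle.trans hle') (hfin.trans hU.symm)).symm ▸ hle) hle'
end

section
open scoped Classical

variable {F V α : Type*} [Field F] [AddCommGroup V] [Module F V] {φ : α → V}

/-- `T` assigns to each `d`-dimensional subspace `U ∈ 𝒰` a set of `t` points of `U`, only a small
proportion of which lies in the span of any `d - 1` of them. -/
structure IsSpreadSystem (φ : α → V) (d r t : ℕ) (𝒰 : Finset (Submodule F V))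
    (T : Submodule F V → Finset α) : Prop where
  finrank_eq : ∀ U ∈ 𝒰, Module.finrank F U = d
  card_eq : ∀ U ∈ 𝒰, (T U).card = t
  mem : ∀ U ∈ 𝒰, ∀ x ∈ T U, φ x ∈ U
  spread : ∀ U ∈ 𝒰, ∀ J ⊆ T U, J.card < d →
    2 ^ (r + 1) * ((T U).filter fun x => φ x ∈ Submodule.span F (φ '' (J : Set α))).card ≤
      (T U).card

/-- All `r`-subsets of the sets `T U` whose subsets of size at most `d` are independent. -/
noncomputable def spreadEdges (φ : α → V) (d r : ℕ) (𝒰 : Finset (Submodule F V))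
    (T : Submodule F V → Finset α) : Finset (Finset α) :=
  𝒰.biUnion fun U => ((T U).powersetCard r).filter (IndepUpTo F φ d)

theorem mem_spreadEdges {d r : ℕ} {𝒰 : Finset (Submodule F V)} {T : Submodule F V → Finset α}
    {e : Finset α} :
    e ∈ spreadEdges φ d r 𝒰 T ↔ ∃ U ∈ 𝒰, (e ⊆ T U ∧ e.card = r) ∧ IndepUpTo F φ d e := by
  simp [spreadEdges, Finset.mem_powersetCard]

namespace IsSpreadSystem

variable [FiniteDimensional F V] {d r t : ℕ} {𝒰 : Finset (Submodule F V)}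
  {T : Submodule F V → Finset α}

theorem eq_of_subset (h : IsSpreadSystem φ d r t 𝒰 T) {U U' : Submodule F V} (hU : U ∈ 𝒰)
    (hU' : U' ∈ 𝒰) {J : Finset α} (hJ : IndepUpTo F φ d J) (hd : d ≤ J.card)
    (hJU : J ⊆ T U) (hJU' : J ⊆ T U') : U = U' :=
  (hJ.span_eq hd (h.finrank_eq U hU) fun x hx => h.mem U hU x (hJU hx)).trans
    (hJ.span_eq hd (h.finrank_eq U' hU') fun x hx => h.mem U' hU' x (hJU' hx)).symm

theorem card_mul_pow_le (h : IsSpreadSystem φ d r t 𝒰 T) (hd : 2 ≤ d) {I : Finset α}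
    (hI : IndepUpTo F φ d I) {l : ℕ} (hl : I.card ≤ l) (hdl : d ≤ l) (hlr : l ≤ r) :
    (𝒰.filter fun U => I ⊆ T U).card * t ^ (l - I.card) ≤ (2 * r) ^ (l - I.card) *
      ((𝒰.filter fun U => I ⊆ T U).biUnion fun U =>
        ((T U).powersetCard l).filter fun J => I ⊆ J ∧ IndepUpTo F φ d J).card := by
  rw [Finset.card_biUnion, Finset.mul_sum, ← smul_eq_mul, ← Finset.sum_const]
  · refine Finset.sum_le_sum fun U hU => ?_
    rw [Finset.mem_filter] at hU
    rw [← h.card_eq U hU.1]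
    exact hI.card_supersets hd (h.spread U hU.1) hU.2 hl hlr
  · intro U hU U' hU' hne
    rw [Function.onFun, Finset.disjoint_left]
    intro J hJ hJ'
    simp only [Finset.mem_coe, Finset.mem_filter, Finset.mem_powersetCard] at hU hU' hJ hJ'
    exact hne (h.eq_of_subset hU.1 hU'.1 hJ.2.2 (by omega) hJ.1.1 hJ'.1.1)

theorem card_mul_pow_le_card_edges (h : IsSpreadSystem φ d r t 𝒰 T) (hd : 2 ≤ d) (hdr : d ≤ r) :
    𝒰.card * t ^ r ≤ (2 * r) ^ r * (spreadEdges φ d r 𝒰 T).card := by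
  simpa [spreadEdges] using h.card_mul_pow_le hd (IndepUpTo.empty d) (Nat.zero_le r) hdr le_rfl

theorem codegree_le (h : IsSpreadSystem φ d r t 𝒰 T) (hd : 2 ≤ d) (hdr : d ≤ r) {P : Finset α}
    (hP : ∀ U ∈ 𝒰, T U ⊆ P) {I : Finset α} (hIr : I.card ≤ r) :
    ((spreadEdges φ d r 𝒰 T).filter fun e => I ⊆ e).card * t ^ (d - I.card) ≤
      (2 * r) ^ r * P.card ^ (d - I.card) * t ^ (r - I.card) := by
  by_cases hI : IndepUpTo F φ d I
  swap
  · have : (spreadEdges φ d r 𝒰 T).filter (fun e => I ⊆ e) = ∅ := by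
      refine Finset.filter_eq_empty_iff.mpr fun e he hIe => hI ?_
      obtain ⟨U, -, -, he⟩ := mem_spreadEdges.mp he
      exact he.mono hIe
    simp [this]
  have hedges : ((spreadEdges φ d r 𝒰 T).filter fun e => I ⊆ e).card ≤
      (𝒰.filter fun U => I ⊆ T U).card * t ^ (r - I.card) := by
    have hsub : ((spreadEdges φ d r 𝒰 T).filter fun e => I ⊆ e) ⊆
        (𝒰.filter fun U => I ⊆ T U).biUnion fun U =>
          ((T U).powersetCard (r - I.card)).image fun J => I ∪ J := by
      intro e he
      obtain ⟨he, hIe⟩ := Finset.mem_filter.mp he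
      obtain ⟨U, hU, ⟨heU, her⟩, -⟩ := mem_spreadEdges.mp he
      simp only [Finset.mem_biUnion, Finset.mem_filter, Finset.mem_image, Finset.mem_powersetCard]
      refine ⟨U, ⟨hU, hIe.trans heU⟩, e \ I, ⟨Finset.sdiff_subset.trans heU, ?_⟩, ?_⟩
      · rw [Finset.card_sdiff_of_subset hIe, her]
      · exact Finset.union_sdiff_of_subset hIe
    refine (Finset.card_le_card hsub).trans (Finset.card_biUnion_le_card_mul _ _ _ fun U hU => ?_)
    refine Finset.card_image_le.trans ?_
    rw [Finset.card_powersetCard, h.card_eq U (Finset.mem_filter.mp hU).1]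
    exact Nat.choose_le_pow _ _
  have hflats : (𝒰.filter fun U => I ⊆ T U).card * t ^ (d - I.card) ≤
      (2 * r) ^ r * P.card ^ (d - I.card) := by
    have h1 := h.card_mul_pow_le hd hI (l := max I.card d) (le_max_left _ _) (le_max_right _ _)
      (max_le hIr hdr)
    have h2 : max I.card d - I.card = d - I.card := by omega
    rw [h2] at h1
    have hsub : ((𝒰.filter fun U => I ⊆ T U).biUnion fun U =>
        ((T U).powersetCard (max I.card d)).filter fun J => I ⊆ J ∧ IndepUpTo F φ d J) ⊆
          (P.powersetCard (d - I.card)).image fun J => I ∪ J := by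
      intro J hJ
      simp only [Finset.mem_biUnion, Finset.mem_filter, Finset.mem_image,
        Finset.mem_powersetCard] at hJ ⊢
      obtain ⟨U, ⟨hU, -⟩, ⟨hJT, hJc⟩, hIJ, -⟩ := hJ
      refine ⟨J \ I, ⟨Finset.sdiff_subset.trans (hJT.trans (hP U hU)), ?_⟩, ?_⟩
      · rw [Finset.card_sdiff_of_subset hIJ, hJc, h2]
      · exact Finset.union_sdiff_of_subset hIJ
    have h3 := (Finset.card_le_card hsub).trans Finset.card_image_le
    rw [Finset.card_powersetCard] at h3
    have h4 := h3.trans (Nat.choose_le_pow _ _)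
    rcases Nat.eq_zero_or_pos r with rfl | hr
    · omega
    refine h1.trans (Nat.mul_le_mul (Nat.pow_le_pow_right (by omega) (by omega)) h4)
  calc _ ≤ ((𝒰.filter fun U => I ⊆ T U).card * t ^ (r - I.card)) * t ^ (d - I.card) := by gcongr
    _ = ((𝒰.filter fun U => I ⊆ T U).card * t ^ (d - I.card)) * t ^ (r - I.card) := by ring
    _ ≤ _ := by gcongr

end IsSpreadSystem
end

section
open scoped Classical

variable {F V α : Type*} [Field F] [AddCommGroup V] [Module F V]

/-- The points of `P` that `φ` sends into the subspace `U`. -/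
noncomputable def pointsIn (φ : α → V) (P : Finset α) (U : Submodule F V) : Finset α :=
  P.filter fun x => φ x ∈ U

variable {φ : α → V} {P : Finset α}

theorem mem_pointsIn {U : Submodule F V} {x : α} : x ∈ pointsIn φ P U ↔ x ∈ P ∧ φ x ∈ U :=
  Finset.mem_filter

theorem pointsIn_mono {U W : Submodule F V} (h : U ≤ W) : pointsIn φ P U ⊆ pointsIn φ P W :=
  fun _ hx => mem_pointsIn.mpr ⟨(mem_pointsIn.mp hx).1, h (mem_pointsIn.mp hx).2⟩

theorem finrank_span_image {J : Finset α} (h : LinearIndepOn F φ (J : Set α)) :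
    Module.finrank F (Submodule.span F (φ '' (J : Set α))) = J.card := by
  have := finrank_span_eq_card h
  rw [← Set.image_eq_range] at this
  rw [this]
  simp

theorem card_pointsIn_le_one [FiniteDimensional F V]
    (hpair : ∀ x ∈ P, ∀ y ∈ P, LinearIndepOn F φ (({x, y} : Finset α) : Set α))
    {U : Submodule F V} (hU : Module.finrank F U ≤ 1) : (pointsIn φ P U).card ≤ 1 := by
  refine Finset.card_le_one.mpr fun x hx y hy => ?_
  rw [mem_pointsIn] at hx hy
  by_contra hne
  have h1 := finrank_span_image (hpair x hx.1 y hy.1)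
  rw [Finset.card_pair hne] at h1
  have h2 : Submodule.span F (φ '' (({x, y} : Finset α) : Set α)) ≤ U := by
    rw [Submodule.span_le]
    rintro _ ⟨z, hz, rfl⟩
    simp only [Finset.coe_insert, Finset.coe_singleton, Set.mem_insert_iff,
      Set.mem_singleton_iff] at hz
    rcases hz with rfl | rfl
    exacts [hx.2, hy.2]
  have h3 := Submodule.finrank_mono h2
  omega

theorem card_rich_ge {Ω : Type*} [Fintype Ω] (A : Ω → Submodule F V) {Q : ℝ} (hQ : 0 < Q)
    (hA : ∀ U : Submodule F V, ((Finset.univ.filter fun ω => U ≤ A ω).card : ℝ) *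
      Q ^ Module.finrank F U ≤ Fintype.card Ω)
    (hx : ∀ x ∈ P, (Fintype.card Ω : ℝ) ≤ (Finset.univ.filter fun ω => φ x ∈ A ω).card * Q)
    (hpair : ∀ x ∈ P, ∀ y ∈ P, LinearIndepOn F φ (({x, y} : Finset α) : Set α))
    (hs : 1 ≤ P.card / Q) :
    (Fintype.card Ω : ℝ) ≤
      8 * (Finset.univ.filter fun ω => (P.card / Q) / 2 ≤ (pointsIn φ P (A ω)).card).card := by
  set N : ℝ := (Fintype.card Ω : ℝ) with hN
  have hN0 : 0 ≤ N := Nat.cast_nonneg _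
  set s : ℝ := P.card / Q with hsdef
  set X : Ω → ℝ := fun ω => (pointsIn φ P (A ω)).card with hX
  have hXsum : ∀ ω, X ω = ∑ x ∈ P, if φ x ∈ A ω then (1 : ℝ) else 0 := by
    intro ω
    simp [hX, pointsIn]
  have hfirst : s * N ≤ ∑ ω, X ω := by
    simp_rw [hXsum]
    rw [Finset.sum_comm]
    have : ∀ x ∈ P, N / Q ≤ ∑ ω, if φ x ∈ A ω then (1 : ℝ) else 0 := by
      intro x hxP
      rw [div_le_iff₀ hQ]
      simpa using hx x hxP
    calc s * N = ∑ x ∈ P, N / Q := by simp [hsdef]; ring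
      _ ≤ _ := Finset.sum_le_sum this
  have hpairs : ∀ x ∈ P, ∀ y ∈ P,
      (∑ ω, (if φ x ∈ A ω then (1 : ℝ) else 0) * (if φ y ∈ A ω then (1 : ℝ) else 0)) ≤
        (if x = y then N / Q else 0) + N / Q ^ 2 := by
    intro x hxP y hyP
    have h1 := hA (Submodule.span F (φ '' (({x, y} : Finset α) : Set α)))
    rw [finrank_span_image (hpair x hxP y hyP)] at h1
    have h2 : (∑ ω, (if φ x ∈ A ω then (1 : ℝ) else 0) * (if φ y ∈ A ω then (1 : ℝ) else 0)) =
        (Finset.univ.filter fun ω =>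
          Submodule.span F (φ '' (({x, y} : Finset α) : Set α)) ≤ A ω).card := by
      rw [Finset.card_filter]
      push_cast
      refine Finset.sum_congr rfl fun ω _ => ?_
      simp only [Submodule.span_le, Set.image_pair, Set.insert_subset_iff,
        Set.singleton_subset_iff, SetLike.mem_coe]
      split_ifs <;> simp_all
    rw [h2]
    rw [← le_div_iff₀ (by positivity)] at h1
    have h3 : 0 ≤ N / Q ^ 2 := by positivity
    by_cases hxy : x = y
    · subst hxy
      simp only [Finset.pair_eq_singleton, Finset.card_singleton, pow_one] at h1
      rw [if_pos rfl]
      simp only [Finset.pair_eq_singleton]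
      linarith
    · rw [Finset.card_pair hxy] at h1
      rw [if_neg hxy]
      linarith
  have hsecond : ∑ ω, X ω ^ 2 ≤ N * (s + s ^ 2) := by
    calc ∑ ω, X ω ^ 2 = ∑ ω, ∑ x ∈ P, ∑ y ∈ P,
          (if φ x ∈ A ω then (1 : ℝ) else 0) * (if φ y ∈ A ω then (1 : ℝ) else 0) := by
          refine Finset.sum_congr rfl fun ω _ => ?_
          rw [hXsum, sq, Finset.sum_mul_sum]
      _ = ∑ x ∈ P, ∑ y ∈ P, ∑ ω,
          (if φ x ∈ A ω then (1 : ℝ) else 0) * (if φ y ∈ A ω then (1 : ℝ) else 0) := by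
          rw [Finset.sum_comm]
          refine Finset.sum_congr rfl fun x _ => Finset.sum_comm
      _ ≤ ∑ x ∈ P, ∑ y ∈ P, ((if x = y then N / Q else 0) + N / Q ^ 2) :=
          Finset.sum_le_sum fun x hx => Finset.sum_le_sum fun y hy => hpairs x hx y hy
      _ = P.card * (N / Q) + P.card * (P.card * (N / Q ^ 2)) := by
          simp [Finset.sum_add_distrib]
      _ = N * (s + s ^ 2) := by
          rw [hsdef]
          field_simp
  set R := Finset.univ.filter fun ω => s / 2 ≤ X ω with hR
  have hhalf : s * N / 2 ≤ ∑ ω ∈ R, X ω := by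
    have h1 := Finset.sum_filter_add_sum_filter_not Finset.univ (fun ω => s / 2 ≤ X ω) X
    have h2 : ∑ ω with ¬ s / 2 ≤ X ω, X ω ≤ N * (s / 2) := by
      calc _ ≤ ∑ ω with ¬ s / 2 ≤ X ω, s / 2 :=
            Finset.sum_le_sum fun ω hω => (not_le.mp (Finset.mem_filter.mp hω).2).le
        _ ≤ ∑ _ω : Ω, s / 2 :=
            Finset.sum_le_sum_of_subset_of_nonneg (Finset.filter_subset _ _)
              fun _ _ _ => by positivity
        _ = N * (s / 2) := by simp [hN]
    linarith
  have hcs : (s * N / 2) ^ 2 ≤ R.card * (N * (s + s ^ 2)) := by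
    calc (s * N / 2) ^ 2 ≤ (∑ ω ∈ R, X ω) ^ 2 := by gcongr
      _ ≤ R.card * ∑ ω ∈ R, X ω ^ 2 := sq_sum_le_card_mul_sum_sq
      _ ≤ R.card * ∑ ω, X ω ^ 2 := by
          gcongr
          exact Finset.subset_univ R
      _ ≤ _ := by gcongr
  rcases hN0.eq_or_lt with h0 | hpos
  · rw [← h0]; positivity
  have hs2 : s + s ^ 2 ≤ 2 * s ^ 2 := by nlinarith
  have h5 : (N * s ^ 2) * N ≤ (N * s ^ 2) * (8 * R.card) := by
    have : (R.card : ℝ) * (N * (s + s ^ 2)) ≤ R.card * (N * (2 * s ^ 2)) := by gcongr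
    nlinarith
  exact le_of_mul_le_mul_left h5 (by positivity)

/-- `U` has dimension `d` and contains at least `a d` points of `P`, while each of its subspaces
of smaller dimension contains fewer than `a (d - 1)` of them. -/
structure IsHeavy (φ : α → V) (P : Finset α) (a : ℕ → ℝ) (d : ℕ) (U : Submodule F V) : Prop where
  finrank_eq : Module.finrank F U = d
  le_card : a d ≤ (pointsIn φ P U).card
  card_lt : ∀ B ≤ U, Module.finrank F B < d → ((pointsIn φ P B).card : ℝ) < a (d - 1)

theorem exists_isHeavy [FiniteDimensional F V]
    (hpair : ∀ x ∈ P, ∀ y ∈ P, LinearIndepOn F φ (({x, y} : Finset α) : Set α))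
    {a : ℕ → ℝ} (ha : Monotone a) (ha0 : 0 < a 0) (ha1 : 1 < a 1) {k : ℕ} {W : Submodule F V}
    (hW : Module.finrank F W ≤ k + 1) (hWP : a (k + 1) ≤ (pointsIn φ P W).card) :
    ∃ d ∈ Finset.Icc 2 (k + 1), ∃ U ≤ W, IsHeavy φ P a d U := by
  have hex : ∃ d, ∃ U ≤ W, Module.finrank F U ≤ d ∧ a d ≤ (pointsIn φ P U).card :=
    ⟨k + 1, W, le_rfl, hW, hWP⟩
  obtain ⟨U, hUW, hUd, hUa⟩ := Nat.find_spec hex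
  have hmin := fun e (he : e < Nat.find hex) => Nat.find_min hex he
  have hle : Nat.find hex ≤ k + 1 := Nat.find_min' hex ⟨W, le_rfl, hW, hWP⟩
  set d := Nat.find hex with hd
  have hd2 : 2 ≤ d := by
    by_contra hlt
    have h1 := card_pointsIn_le_one hpair (U := U) (by omega)
    have h2 : ((pointsIn φ P U).card : ℝ) ≤ 1 := by exact_mod_cast h1
    have hd01 : d = 0 ∨ d = 1 := by omega
    rcases hd01 with h | h
    · rw [h] at hUa hUd
      have hbot : U = ⊥ := Submodule.finrank_eq_zero.mp (by omega)
      have hne : (pointsIn φ P U).Nonempty := by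
        rw [← Finset.card_pos]
        exact_mod_cast ha0.trans_le hUa
      obtain ⟨x, hx⟩ := hne
      rw [mem_pointsIn, hbot, Submodule.mem_bot] at hx
      exact (hpair x hx.1 x hx.1).ne_zero (i := x) (by simp) hx.2
    · rw [h] at hUa
      linarith
  have hlt : ∀ B ≤ U, Module.finrank F B < d → ((pointsIn φ P B).card : ℝ) < a (d - 1) := by
    intro B hB hBd
    by_contra hge
    exact hmin (d - 1) (by omega) ⟨B, hB.trans hUW, by omega, not_lt.mp hge⟩
  refine ⟨d, Finset.mem_Icc.mpr ⟨hd2, hle⟩, U, hUW, ?_, hUa, hlt⟩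
  by_contra hne
  have h1 := hlt U le_rfl (by omega)
  have h2 : a (d - 1) ≤ a d := ha (Nat.sub_le d 1)
  linarith

theorem exists_isSpreadSystem [Finite V] {Ω : Type*} [Fintype Ω] [Nonempty Ω]
    (A : Ω → Submodule F V) {Q : ℝ} (hQ : 0 < Q)
    (hA : ∀ U : Submodule F V, ((Finset.univ.filter fun ω => U ≤ A ω).card : ℝ) *
      Q ^ Module.finrank F U ≤ Fintype.card Ω)
    (hx : ∀ x ∈ P, (Fintype.card Ω : ℝ) ≤ (Finset.univ.filter fun ω => φ x ∈ A ω).card * Q)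
    (hpair : ∀ x ∈ P, ∀ y ∈ P, LinearIndepOn F φ (({x, y} : Finset α) : Set α))
    {k : ℕ} (r : ℕ) (hdim : ∀ ω, Module.finrank F (A ω) ≤ k + 1)
    (hs : 1 < (1 / 2 ^ (r + 1)) ^ k / 2 * (P.card / Q)) :
    ∃ (d t : ℕ) (𝒰 : Finset (Submodule F V)) (T : Submodule F V → Finset α),
      2 ≤ d ∧ d ≤ k + 1 ∧ IsSpreadSystem φ d r t 𝒰 T ∧
      (∀ U ∈ 𝒰, T U ⊆ P ∧ ∃ ω, U ≤ A ω) ∧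
      (1 / 2 ^ (r + 1)) ^ k / 2 * (P.card / Q) ≤ (t : ℝ) ∧
      Q ^ d ≤ 8 * k * 𝒰.card := by
  have : Fintype (Submodule F V) := Fintype.ofFinite _
  set η : ℝ := 1 / 2 ^ (r + 1) with hη
  have hη0 : 0 < η := by positivity
  have hη1 : η ≤ 1 := by
    rw [hη, div_le_one (by positivity)]
    exact one_le_pow₀ (by norm_num)
  set s : ℝ := P.card / Q with hsdef
  have hs0 : 0 < s := by
    by_contra hneg
    have : η ^ k / 2 * s ≤ 0 := mul_nonpos_of_nonneg_of_nonpos (by positivity) (not_lt.mp hneg)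
    linarith
  have hs1 : 1 ≤ s := by
    have h1 : η ^ k ≤ 1 := pow_le_one₀ hη0.le hη1
    nlinarith
  set a : ℕ → ℝ := fun d => η ^ (k + 1 - d) / 2 * s with ha
  have hmono : Monotone a := by
    intro d e hde
    simp only [ha]
    have : η ^ (k + 1 - d) ≤ η ^ (k + 1 - e) := pow_le_pow_of_le_one hη0.le hη1 (by omega)
    gcongr
  set 𝒰 : ℕ → Finset (Submodule F V) := fun d =>
    Finset.univ.filter fun U => IsHeavy φ P a d U ∧ ∃ ω, U ≤ A ω with h𝒰
  set N : ℝ := (Fintype.card Ω : ℝ) with hN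
  have hN0 : 0 < N := by
    rw [hN]
    exact_mod_cast Fintype.card_pos
  have hrich := card_rich_ge A hQ hA hx hpair hs1
  have hcover : (Finset.univ.filter fun ω => s / 2 ≤ (pointsIn φ P (A ω)).card) ⊆
      (Finset.Icc 2 (k + 1)).biUnion fun d => (𝒰 d).biUnion fun U =>
        Finset.univ.filter fun ω => U ≤ A ω := by
    intro ω hω
    obtain ⟨d, hd, U, hU, hheavy⟩ := exists_isHeavy hpair hmono (by simp only [ha]; positivity)
      (by simpa [ha] using hs) (hdim ω)
      (by simpa [ha, div_eq_mul_inv, mul_comm] using (Finset.mem_filter.mp hω).2)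
    simp only [Finset.mem_biUnion]
    exact ⟨d, hd, U, by simp only [h𝒰, Finset.mem_filter]; exact ⟨by simp, hheavy, ω, hU⟩,
      by simpa using hU⟩
  have hsum : N ≤ ∑ d ∈ Finset.Icc 2 (k + 1), 8 * ((𝒰 d).card * (N / Q ^ d)) := by
    rw [← Finset.mul_sum]
    refine hrich.trans (mul_le_mul_of_nonneg_left ?_ (by norm_num))
    have h1 := (Finset.card_le_card hcover).trans Finset.card_biUnion_le
    have h2 : ((Finset.univ.filter fun ω => s / 2 ≤ (pointsIn φ P (A ω)).card).card : ℝ) ≤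
        ∑ d ∈ Finset.Icc 2 (k + 1), (((𝒰 d).biUnion fun U =>
          Finset.univ.filter fun ω => U ≤ A ω).card : ℝ) := by exact_mod_cast h1
    refine h2.trans (Finset.sum_le_sum fun d _ => ?_)
    have h3 : (((𝒰 d).biUnion fun U => Finset.univ.filter fun ω => U ≤ A ω).card : ℝ) ≤
        ∑ U ∈ 𝒰 d, ((Finset.univ.filter fun ω => U ≤ A ω).card : ℝ) := by
      exact_mod_cast Finset.card_biUnion_le
    refine h3.trans ?_
    rw [← nsmul_eq_mul, ← Finset.sum_const]
    refine Finset.sum_le_sum fun U hU => ?_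
    rw [le_div_iff₀ (by positivity)]
    rw [← (Finset.mem_filter.mp hU).2.1.finrank_eq]
    exact hA U
  have hkpos : 1 ≤ k := by
    by_contra hk
    have hk0 : k = 0 := by omega
    subst hk0
    simp at hsum
    linarith
  obtain ⟨d, hd, hdle⟩ : ∃ d ∈ Finset.Icc 2 (k + 1), N / k ≤ 8 * ((𝒰 d).card * (N / Q ^ d)) := by
    refine Finset.exists_le_of_sum_le (Finset.nonempty_Icc.mpr (by omega)) ?_
    refine le_trans (le_of_eq ?_) hsum
    have : (k : ℝ) ≠ 0 := by positivity
    simp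
    field_simp
  rw [Finset.mem_Icc] at hd
  have hT : ∀ U : Submodule F V, ∃ T : Finset α, U ∈ 𝒰 d → T ⊆ pointsIn φ P U ∧
      T.card = ⌈a d⌉₊ := by
    intro U
    by_cases hU : U ∈ 𝒰 d
    · obtain ⟨T, hT⟩ := Finset.exists_subset_card_eq (s := pointsIn φ P U) (n := ⌈a d⌉₊)
        (Nat.ceil_le.mpr (Finset.mem_filter.mp hU).2.1.le_card)
      exact ⟨T, fun _ => hT⟩
    · exact ⟨∅, fun h => absurd h hU⟩
  choose T hT using hT
  refine ⟨d, ⌈a d⌉₊, 𝒰 d, T, hd.1, hd.2, ⟨?_, ?_, ?_, ?_⟩, ?_, ?_, ?_⟩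
  · exact fun U hU => (Finset.mem_filter.mp hU).2.1.finrank_eq
  · exact fun U hU => (hT U hU).2
  · exact fun U hU x hx => (mem_pointsIn.mp ((hT U hU).1 hx)).2
  · intro U hU J hJ hJd
    obtain ⟨hTU, hTc⟩ := hT U hU
    have hheavy := (Finset.mem_filter.mp hU).2.1
    have hspan : Submodule.span F (φ '' (J : Set α)) ≤ U := by
      rw [Submodule.span_le]
      rintro _ ⟨x, hx, rfl⟩
      exact (mem_pointsIn.mp (hTU (hJ hx))).2
    have hrank : Module.finrank F (Submodule.span F (φ '' (J : Set α))) < d := by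
      refine lt_of_le_of_lt ?_ hJd
      rw [← Finset.coe_image]
      exact (finrank_span_finset_le_card _).trans Finset.card_image_le
    have h1 := hheavy.card_lt _ hspan hrank
    have h2 : a (d - 1) = η * a d := by
      simp only [ha]
      rw [show k + 1 - (d - 1) = (k + 1 - d) + 1 by omega, pow_succ]
      ring
    have h3 : ((T U).filter fun x => φ x ∈ Submodule.span F (φ '' (J : Set α))).card ≤
        (pointsIn φ P (Submodule.span F (φ '' (J : Set α)))).card := by
      refine Finset.card_le_card fun x hx => ?_
      rw [Finset.mem_filter] at hx
      exact mem_pointsIn.mpr ⟨(mem_pointsIn.mp (hTU hx.1)).1, hx.2⟩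
    have h4 : (((T U).filter fun x => φ x ∈ Submodule.span F (φ '' (J : Set α))).card : ℝ) ≤
        η * a d := (Nat.cast_le.mpr h3).trans (h1.le.trans h2.le)
    have h5 : (2 : ℝ) ^ (r + 1) *
        ((T U).filter fun x => φ x ∈ Submodule.span F (φ '' (J : Set α))).card ≤ (T U).card := by
      calc _ ≤ (2 : ℝ) ^ (r + 1) * (η * a d) := by gcongr
        _ = a d := by rw [hη]; field_simp
        _ ≤ _ := by rw [hTc]; exact Nat.le_ceil _
    exact_mod_cast h5
  · intro U hU
    exact ⟨fun x hx => (mem_pointsIn.mp ((hT U hU).1 hx)).1, (Finset.mem_filter.mp hU).2.2⟩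
  · refine le_trans ?_ (Nat.le_ceil _)
    have := hmono (show 1 ≤ d by omega)
    simpa [ha] using this
  · have hk0 : (0 : ℝ) < k := by exact_mod_cast hkpos
    have hQd : 0 < Q ^ d := by positivity
    rw [div_le_iff₀ hk0] at hdle
    have h6 : N * Q ^ d ≤ N * (8 * k * (𝒰 d).card) := by
      calc N * Q ^ d ≤ (8 * ((𝒰 d).card * (N / Q ^ d)) * k) * Q ^ d := by gcongr
        _ = _ := by field_simp
    exact le_of_mul_le_mul_left h6 hN0
end

section
open scoped Classical

variable {F : Type*} [Field F]

theorem card_graph_ge [Fintype F] {V W : Type*} [AddCommGroup V] [Module F V] [AddCommGroup W] [Module F W]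
    [FiniteDimensional F V] [FiniteDimensional F W] [Fintype (V →ₗ[F] W)]
    (U : Submodule F (V × W)) :
    (Finset.univ.filter fun L : V →ₗ[F] W => U ≤ L.graph).card *
      ((Fintype.card F) ^ Module.finrank F W) ^ Module.finrank F U ≤
        Fintype.card (V →ₗ[F] W) := by
  rcases Finset.eq_empty_or_nonempty (Finset.univ.filter fun L : V →ₗ[F] W => U ≤ L.graph)
    with h0 | ⟨L₀, hL₀⟩
  · simp [h0]
  have hinj : Function.Injective ((LinearMap.fst F V W).comp U.subtype) := by
    intro x y hxy
    have hL := (Finset.mem_filter.mp hL₀).2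
    have hx := (LinearMap.mem_graph_iff _ _).mp (hL x.2)
    have hy := (LinearMap.mem_graph_iff _ _).mp (hL y.2)
    have hxy1 : x.1.1 = y.1.1 := hxy
    exact Subtype.ext (Prod.ext hxy1 (by rw [hx, hy, hxy1]))
  obtain ⟨g, hg⟩ := LinearMap.exists_leftInverse_of_injective _ (LinearMap.ker_eq_bot.mpr hinj)
  have : Finite (U →ₗ[F] W) := Module.finite_of_finite F
  have : Fintype (U →ₗ[F] W) := Fintype.ofFinite _
  have hcard : Fintype.card (U →ₗ[F] W) =
      ((Fintype.card F) ^ Module.finrank F W) ^ Module.finrank F U := by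
    rw [Module.card_eq_pow_finrank (K := F), Module.finrank_linearMap, mul_comm, pow_mul]
  rw [← hcard, ← Finset.card_univ, ← Finset.card_univ, ← Finset.card_product]
  refine Finset.card_le_card_of_injOn (fun p => p.1 + p.2.comp g) (by simp) ?_
  rintro ⟨L, f⟩ h ⟨L', f'⟩ h' heq
  simp only [Finset.coe_product, Set.mem_prod, Finset.mem_coe, Finset.mem_filter,
    Finset.mem_univ, true_and, and_true] at h h'
  have hff : f = f' := by
    ext u
    have h1 := LinearMap.congr_fun heq u.1.1
    have h2 : g u.1.1 = u := LinearMap.congr_fun hg u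
    have h3 := (LinearMap.mem_graph_iff _ _).mp (h u.2)
    have h4 := (LinearMap.mem_graph_iff _ _).mp (h' u.2)
    simp only [LinearMap.add_apply, LinearMap.comp_apply, h2, ← h3, ← h4] at h1
    exact add_left_cancel h1
  subst hff
  exact Prod.ext (add_right_cancel heq) rfl

theorem card_le_card_mem_graph [Fintype F] {E W : Type*} [AddCommGroup E] [Module F E] [AddCommGroup W]
    [Module F W] [FiniteDimensional F E] [FiniteDimensional F W] [Fintype ((F × E) →ₗ[F] W)]
    (x : E) (y : W) :
    Fintype.card ((F × E) →ₗ[F] W) ≤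
      (Finset.univ.filter fun L : (F × E) →ₗ[F] W => (((1, x), y) : (F × E) × W) ∈ L.graph).card *
        (Fintype.card F) ^ Module.finrank F W := by
  have : Finite W := Module.finite_of_finite F
  have : Fintype W := Fintype.ofFinite _
  rw [← Module.card_eq_pow_finrank (K := F), ← Finset.card_univ, ← Finset.card_univ,
    ← Finset.card_product]
  refine Finset.card_le_card_of_injOn
    (fun L => (L + (LinearMap.fst F F E).smulRight (y - L (1, x)), L (1, x))) ?_ ?_
  · intro L _
    simp [LinearMap.mem_graph_iff]
  · intro L _ L' _ h
    obtain ⟨h1, h2⟩ := Prod.mk.inj h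
    rw [h2] at h1
    exact add_right_cancel h1

theorem finrank_graph {V W : Type*} [AddCommGroup V] [Module F V] [AddCommGroup W] [Module F W]
    (L : V →ₗ[F] W) : Module.finrank F L.graph = Module.finrank F V := by
  rw [LinearMap.graph_eq_range_prod]
  exact LinearMap.finrank_range_of_inj fun x y h => (Prod.mk.inj h).1

theorem linearIndepOn_pair_lift {α E W : Type*} [AddCommGroup E] [Module F E] [AddCommGroup W]
    [Module F W] {ψ : α → E × W} (hψ : Function.Injective ψ) (x y : α) :
    LinearIndepOn F (fun p => (((1, (ψ p).1), (ψ p).2) : (F × E) × W))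
      (({x, y} : Finset α) : Set α) := by
  by_cases hxy : x = y
  · subst hxy
    simp
  · rw [Finset.coe_pair, LinearIndepOn.pair_iff _ hxy]
    intro a b hab
    simp only [Prod.smul_mk, Prod.mk_add_mk, Prod.mk_eq_zero, smul_eq_mul, mul_one] at hab
    obtain ⟨⟨h1, h2⟩, h3⟩ := hab
    have hb : b = -a := by linear_combination h1
    subst hb
    have ha : a = 0 := by
      by_contra ha
      refine hxy (hψ (Prod.ext ?_ ?_))
      · rw [neg_smul, ← sub_eq_add_neg, ← smul_sub, smul_eq_zero] at h2
        exact sub_eq_zero.mp (h2.resolve_left ha)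
      · rw [neg_smul, ← sub_eq_add_neg, ← smul_sub, smul_eq_zero] at h3
        exact sub_eq_zero.mp (h3.resolve_left ha)
    simp [ha]

/-- The graph of an affine map is an affine subspace. -/
theorem exists_affineSubspace_of_graph {M E W : Type*} [AddCommGroup M] [Module F M]
    [AddCommGroup E] [Module F E] [AddCommGroup W] [Module F W] (ψ : M ≃ₗ[F] E × W)
    (L : (F × E) →ₗ[F] W) :
    ∃ S : AffineSubspace F M, Module.finrank F S.direction = Module.finrank F E ∧
      ∀ p : M, (((1, (ψ p).1), (ψ p).2) : (F × E) × W) ∈ L.graph → p ∈ S := by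
  let D : E →ₗ[F] M := ψ.symm.toLinearMap.comp
    (LinearMap.id.prod (L.comp (LinearMap.inr F F E)))
  have hD : Function.Injective D := fun x y h => (Prod.mk.inj (ψ.symm.injective h)).1
  refine ⟨AffineSubspace.mk' (ψ.symm (0, L (1, 0))) (LinearMap.range D), ?_, fun p hp => ?_⟩
  · rw [AffineSubspace.direction_mk']
    exact LinearMap.finrank_range_of_inj hD
  · rw [AffineSubspace.mem_mk', vsub_eq_sub]
    refine ⟨(ψ p).1, ψ.injective ?_⟩
    have h2 : (ψ p).2 = L (1, (ψ p).1) := (LinearMap.mem_graph_iff _ _).mp hp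
    have h3 : L (1, (ψ p).1) = L (1, 0) + L (0, (ψ p).1) := by
      rw [← map_add]
      simp
    ext1
    · simp [D]
    · simp [D, h2, h3]
end

section

variable {k d i r : ℕ} {t m Q g ε D : ℝ}

theorem degree_mul_le (hε : 0 < ε) (hε1 : ε ≤ 1) (hD : 0 ≤ D) (ht : 0 < t) (hm : 0 ≤ m)
    (hQ : 0 < Q) (hg : 0 ≤ g) (hdk : d ≤ k + 1) (h2 : g * t ^ (d - i) ≤ D * m ^ (d - i) * t ^ (r - i))
    (h3 : ε * m ≤ t * Q) :
    g * m * ε ^ (k + 2) ≤ D * Q ^ (d - i + 1) * t ^ (r - i + 1) := by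
  have hB : g * ε ^ (d - i) ≤ D * Q ^ (d - i) * t ^ (r - i) := by
    refine le_of_mul_le_mul_right (a := t ^ (d - i)) ?_ (by positivity)
    calc g * ε ^ (d - i) * t ^ (d - i) = (g * t ^ (d - i)) * ε ^ (d - i) := by ring
      _ ≤ (D * m ^ (d - i) * t ^ (r - i)) * ε ^ (d - i) := by gcongr
      _ = D * (ε * m) ^ (d - i) * t ^ (r - i) := by rw [mul_pow]; ring
      _ ≤ D * (t * Q) ^ (d - i) * t ^ (r - i) := by gcongr
      _ = _ := by rw [mul_pow]; ring
  calc g * m * ε ^ (k + 2) = g * ε ^ (k + 1) * (ε * m) := by ring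
    _ ≤ g * ε ^ (d - i) * (ε * m) := by
        gcongr ?_ * _
        exact mul_le_mul_of_nonneg_left (pow_le_pow_of_le_one hε.le hε1 (by omega)) hg
    _ ≤ (D * Q ^ (d - i) * t ^ (r - i)) * (t * Q) := by gcongr
    _ = _ := by ring

theorem codegree_bound {k d i r q : ℕ} {t m Q g c e ε D θ : ℝ} (hk : 1 ≤ k) (hi : 2 ≤ i)
    (hir : i ≤ r) (hdk : d ≤ k + 1) (hd : 2 ≤ d) (hε : 0 < ε) (hε1 : ε ≤ 1) (hD : 0 < D)
    (ht : 0 < t) (hm : 0 < m) (hg : 0 ≤ g) (he : 0 ≤ e) (hc : 0 < c)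
    (hθ : θ = 8 * k * D ^ 2 / ε ^ (k + 2)) (hθε : 1 < θ * ε) (hq : (1 : ℝ) ≤ q) (hqQ : q ≤ Q)
    (hqc : θ / c ≤ √q) (htQ : ε * m ≤ t * Q) (hedges : Q ^ d * t ^ r ≤ 8 * k * D * e)
    (hcodeg : g * t ^ (d - i) ≤ D * m ^ (d - i) * t ^ (r - i)) :
    g ≤ c * (θ * Q / (m * (q : ℝ) ^ ((1 : ℝ) / (2 * r)))) ^ (i - 1) * e / m := by
  have hk0 : (0 : ℝ) < k := by exact_mod_cast hk
  have hQ : 0 < Q := by linarith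
  have hθ0 : 0 < θ := by rw [hθ]; positivity
  have h1 := degree_mul_le hε hε1 hD.le ht hm.le hQ hg hdk hcodeg htQ
  set S := √(q : ℝ) with hS
  have hS0 : 0 < S := Real.sqrt_pos.mpr (by linarith)
  have hSq : S * S = q := Real.mul_self_sqrt (by linarith)
  set w : ℝ := (q : ℝ) ^ ((1 : ℝ) / (2 * r)) with hw
  have hw1 : 1 ≤ w := Real.one_le_rpow hq (by positivity)
  have hwS : w ^ (i - 1) ≤ S := by
    calc w ^ (i - 1) ≤ w ^ r := pow_le_pow_right₀ hw1 (by omega)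
      _ = S := by
        rw [hw, ← Real.rpow_natCast, ← Real.rpow_mul (by linarith), hS, Real.sqrt_eq_rpow]
        congr 1
        have : (r : ℝ) ≠ 0 := by
          have : r ≠ 0 := by omega
          exact_mod_cast this
        field_simp
  set τ := θ * Q / (m * w) with hτ
  have hτw : 1 ≤ τ * (t * w) := by
    rw [hτ, div_mul_eq_mul_div, le_div_iff₀ (by positivity)]
    calc 1 * (m * w) ≤ (θ * ε) * (m * w) := by gcongr
      _ = θ * w * (ε * m) := by ring
      _ ≤ θ * w * (t * Q) := by gcongr
      _ = _ := by ring
  have hτ0 : 0 < τ := by positivity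
  have hτS : 1 ≤ τ ^ (i - 1) * t ^ (i - 1) * S := by
    calc (1 : ℝ) ≤ (τ * (t * w)) ^ (i - 1) := one_le_pow₀ hτw
      _ = τ ^ (i - 1) * t ^ (i - 1) * w ^ (i - 1) := by rw [mul_pow, mul_pow]; ring
      _ ≤ _ := by gcongr
  have h2 : g * m * ε ^ (k + 2) * t ^ (i - 1) * Q ≤ 8 * k * D ^ 2 * e := by
    calc g * m * ε ^ (k + 2) * t ^ (i - 1) * Q
        ≤ (D * Q ^ (d - i + 1) * t ^ (r - i + 1)) * t ^ (i - 1) * Q := by gcongr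
      _ = D * (Q ^ (d - i + 2) * t ^ (r - i + 1 + (i - 1))) := by
          rw [pow_add t]
          ring
      _ ≤ D * (Q ^ d * t ^ r) := by
          rw [show r - i + 1 + (i - 1) = r by omega]
          gcongr
          · linarith
          · omega
      _ ≤ D * (8 * k * D * e) := by gcongr
      _ = _ := by ring
  have h3 : g * m * t ^ (i - 1) * Q ≤ θ * e := by
    rw [hθ, div_mul_eq_mul_div, le_div_iff₀ (by positivity)]
    linarith
  have h4 : g * m * t ^ (i - 1) * S ≤ c * e := by
    refine le_of_mul_le_mul_right (a := S) ?_ hS0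
    calc g * m * t ^ (i - 1) * S * S = g * m * t ^ (i - 1) * q := by
          rw [← hSq]
          ring
      _ ≤ g * m * t ^ (i - 1) * Q := by gcongr
      _ ≤ θ * e := h3
      _ = c * e * (θ / c) := by field_simp
      _ ≤ c * e * S := by gcongr
  rw [le_div_iff₀ hm]
  calc g * m ≤ g * m * (τ ^ (i - 1) * t ^ (i - 1) * S) :=
        le_mul_of_one_le_right (by positivity) hτS
    _ = τ ^ (i - 1) * (g * m * t ^ (i - 1) * S) := by ring
    _ ≤ τ ^ (i - 1) * (c * e) := by gcongr
    _ = _ := by ring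

theorem degree_bound {e θ : ℝ} (hr : 1 ≤ r) (hdk : d ≤ k + 1)
    (hd : 1 ≤ d) (hε : 0 < ε) (hε1 : ε ≤ 1) (hD : 0 < D) (ht : 0 < t) (hm : 0 < m) (hQ : 0 < Q)
    (hg : 0 ≤ g) (hθ : θ = 8 * k * D ^ 2 / ε ^ (k + 2)) (htQ : ε * m ≤ t * Q)
    (hedges : Q ^ d * t ^ r ≤ 8 * k * D * e)
    (hdeg : g * t ^ (d - 1) ≤ D * m ^ (d - 1) * t ^ (r - 1)) :
    g ≤ θ * e / m := by
  have h1 := degree_mul_le hε hε1 hD.le ht hm.le hQ hg hdk hdeg htQ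
  rw [Nat.sub_add_cancel hd, Nat.sub_add_cancel hr] at h1
  rw [le_div_iff₀ hm, hθ, div_mul_eq_mul_div, le_div_iff₀ (by positivity)]
  calc _ ≤ D * Q ^ d * t ^ r := h1
    _ = D * (Q ^ d * t ^ r) := by ring
    _ ≤ D * (8 * k * D * e) := by gcongr
    _ = _ := by ring

end

section
open scoped Classical

theorem exists_family_of_flat_subsets {F M E W : Type*} [Field F] [Fintype F] [AddCommGroup M]
    [Module F M] [AddCommGroup E] [Module F E] [AddCommGroup W] [Module F W]
    [FiniteDimensional F E] [FiniteDimensional F W] (ψ : M ≃ₗ[F] E × W) {k r : ℕ}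
    (hE : Module.finrank F E = k) (hr : k < r) (P : Finset M) {Q : ℝ}
    (hQF : Q = (Fintype.card F : ℝ) ^ Module.finrank F W)
    (hs : 1 < (1 / 2 ^ (r + 1)) ^ k / 2 * (P.card / Q)) :
    ∃ (d : ℕ) (t : ℝ) (H : Finset (Finset M)), 2 ≤ d ∧ d ≤ k + 1 ∧ 0 < t ∧
      (1 / 2 ^ (r + 1)) ^ k / 2 * P.card ≤ t * Q ∧
      Q ^ d * t ^ r ≤ 8 * k * (2 * r) ^ r * H.card ∧
      (∀ e ∈ H, e ⊆ P ∧ e.card = r ∧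
        ∃ S : AffineSubspace F M, Module.finrank F S.direction = k ∧ (e : Set M) ⊆ (S : Set M)) ∧
      ∀ I : Finset M, I.card ≤ r →
        ((H.filter fun e => I ⊆ e).card : ℝ) * t ^ (d - I.card) ≤
          (2 * r) ^ r * (P.card : ℝ) ^ (d - I.card) * t ^ (r - I.card) := by
  have hQ : 0 < Q := by
    have : 0 < Fintype.card F := Fintype.card_pos
    rw [hQF]
    positivity
  let φ : M → (F × E) × W := fun p => ((1, (ψ p).1), (ψ p).2)
  have : Finite ((F × E) × W) := Module.finite_of_finite F
  have : Finite ((F × E) →ₗ[F] W) := Module.finite_of_finite F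
  have : Fintype ((F × E) →ₗ[F] W) := Fintype.ofFinite _
  have hA : ∀ U : Submodule F ((F × E) × W),
      ((Finset.univ.filter fun L : (F × E) →ₗ[F] W => U ≤ L.graph).card : ℝ) *
        Q ^ Module.finrank F U ≤ Fintype.card ((F × E) →ₗ[F] W) := by
    intro U
    rw [hQF]
    exact_mod_cast card_graph_ge U
  have hx : ∀ x ∈ P, (Fintype.card ((F × E) →ₗ[F] W) : ℝ) ≤
      (Finset.univ.filter fun L : (F × E) →ₗ[F] W => φ x ∈ L.graph).card * Q := by
    intro x _
    rw [hQF]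
    exact_mod_cast card_le_card_mem_graph (F := F) (ψ x).1 (ψ x).2
  have hdim : ∀ L : (F × E) →ₗ[F] W, Module.finrank F L.graph ≤ k + 1 := by
    intro L
    rw [finrank_graph, Module.finrank_prod, Module.finrank_self, hE]
    omega
  obtain ⟨d, t, 𝒰, T, hd2, hdk, hsys, hT, ht, hu⟩ :=
    exists_isSpreadSystem (fun L : (F × E) →ₗ[F] W => L.graph) hQ hA hx
      (fun x _ y _ => linearIndepOn_pair_lift ψ.injective x y) r hdim hs
  refine ⟨d, t, spreadEdges φ d r 𝒰 T, hd2, hdk, by linarith, ?_, ?_, ?_, fun I hI => ?_⟩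
  · rwa [mul_div_assoc', div_le_iff₀ hQ] at ht
  · have h1 : (𝒰.card : ℝ) * (t : ℝ) ^ r ≤ (2 * r) ^ r * (spreadEdges φ d r 𝒰 T).card := by
      exact_mod_cast hsys.card_mul_pow_le_card_edges hd2 (by omega)
    calc Q ^ d * (t : ℝ) ^ r ≤ (8 * k * 𝒰.card) * (t : ℝ) ^ r := by gcongr
      _ = 8 * k * (𝒰.card * (t : ℝ) ^ r) := by ring
      _ ≤ 8 * k * ((2 * r) ^ r * (spreadEdges φ d r 𝒰 T).card) := by gcongr
      _ = _ := by ring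
  · intro e he
    obtain ⟨U, hU, ⟨heT, her⟩, -⟩ := mem_spreadEdges.mp he
    obtain ⟨hTP, L, hL⟩ := hT U hU
    obtain ⟨S, hS, hmem⟩ := exists_affineSubspace_of_graph ψ L
    refine ⟨heT.trans hTP, her, S, hS.trans hE, fun p hp => ?_⟩
    exact hmem p (hL (hsys.mem U hU p (heT hp)))
  · exact_mod_cast hsys.codegree_le hd2 (by omega) (fun U hU => (hT U hU).1) hI

end


/-- **balanced supersaturation.** For all integers `1 ≤ k < n`, every integer
`r > k`, and every real `c > 0`, there exists `θ > 0` such that for all sufficiently large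
prime powers `q` (i.e. all finite fields `F` of sufficiently large cardinality `q`) the
following holds. If `P ⊆ F^n` satisfies `|P| ≥ θ·q^(n-k)` and `|P ∩ W| ≤ 2|P|/√q` for every
`k`-dimensional affine subspace `W` of `F^n`, then there is a nonempty family `E` of
`(k, r)`-sets (sets of `r` points contained in a `k`-flat) contained in `P` such that,
setting `τ = θ·q^(n-k)/(|P|·q^(1/(2r)))`: (i) for every `2 ≤ i ≤ r`, every `i`-element
subset of `P` lies in at most `c·τ^(i-1)·|E|/|P|` members of `E`, and (ii) every point of `P`
lies in at most `θ·|E|/|P|` members of `E`. -/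
theorem statement10 (k n r : ℕ) (hk : 1 ≤ k) (hkn : k < n) (hr : k < r) (c : ℝ) (hc : 0 < c) :
    ∃ θ : ℝ, 0 < θ ∧
      ∃ q0 : ℕ, ∀ q : ℕ, q0 ≤ q → IsPrimePow q →
        ∀ (F : Type) [Field F] [Fintype F], Fintype.card F = q →
          ∀ P : Finset (Fin n → F),
            θ * (q : ℝ) ^ (n - k) ≤ (P.card : ℝ) →
            (∀ W : AffineSubspace F (Fin n → F), Module.finrank F W.direction = k →
              (((P : Set (Fin n → F)) ∩ (W : Set (Fin n → F))).ncard : ℝ) ≤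
                2 * P.card / Real.sqrt q) →
            ∃ E : Finset (Finset (Fin n → F)),
              E.Nonempty ∧
              (∀ e ∈ E, e ⊆ P ∧ e.card = r ∧
                ∃ W : AffineSubspace F (Fin n → F), Module.finrank F W.direction = k ∧
                  (e : Set (Fin n → F)) ⊆ (W : Set (Fin n → F))) ∧
              (∀ i : ℕ, 2 ≤ i → i ≤ r →
                ∀ I : Finset (Fin n → F), I ⊆ P → I.card = i →
                  ({e : Finset (Fin n → F) | e ∈ E ∧ I ⊆ e}.ncard : ℝ) ≤
                    c * (θ * (q : ℝ) ^ (n - k) / (P.card * (q : ℝ) ^ ((1 : ℝ) / (2 * r))))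
                        ^ (i - 1) *
                      E.card / P.card) ∧
              (∀ x ∈ P,
                ({e : Finset (Fin n → F) | e ∈ E ∧ x ∈ e}.ncard : ℝ) ≤ θ * E.card / P.card) := by
  have hk1 : (1 : ℝ) ≤ k := by exact_mod_cast hk
  set ε : ℝ := (1 / 2 ^ (r + 1)) ^ k / 2 with hεdef
  have hε : 0 < ε := by positivity
  have hε1 : ε ≤ 1 := by
    have h1 : (1 / 2 ^ (r + 1) : ℝ) ≤ 1 := by
      rw [div_le_one (by positivity)]
      exact one_le_pow₀ (by norm_num)
    have h2 : (1 / 2 ^ (r + 1) : ℝ) ^ k ≤ 1 := pow_le_one₀ (by positivity) h1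
    rw [hεdef]
    linarith
  set D : ℝ := (2 * r) ^ r with hDdef
  have hD : 1 ≤ D := by
    refine one_le_pow₀ ?_
    have : (1 : ℝ) ≤ r := by exact_mod_cast (show 1 ≤ r by omega)
    linarith
  set θ : ℝ := 8 * k * D ^ 2 / ε ^ (k + 2) with hθdef
  have hθ : 0 < θ := by positivity
  have hθε : 1 < θ * ε := by
    have h1 : θ * ε = 8 * k * D ^ 2 / ε ^ (k + 1) := by
      rw [hθdef, pow_succ ε (k + 1)]
      field_simp
    rw [h1, lt_div_iff₀ (by positivity), one_mul]
    have h2 : ε ^ (k + 1) ≤ 1 := pow_le_one₀ hε.le hε1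
    have h4 : 1 ≤ D ^ 2 := one_le_pow₀ hD
    nlinarith
  refine ⟨θ, hθ, ⌈(θ / c) ^ 2⌉₊ + 1, fun q hq _ F _ _ hF P hP _ => ?_⟩
  classical
  have hq1 : (1 : ℝ) ≤ q := by exact_mod_cast (show 1 ≤ q by omega)
  have hqc : θ / c ≤ √q := by
    refine Real.le_sqrt_of_sq_le ((Nat.le_ceil _).trans ?_)
    exact_mod_cast (show ⌈(θ / c) ^ 2⌉₊ ≤ q by omega)
  have hqQ : (q : ℝ) ≤ (q : ℝ) ^ (n - k) := le_self_pow₀ hq1 (by omega)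
  have hQF : (q : ℝ) ^ (n - k) = (Fintype.card F : ℝ) ^ (n - k) := by rw [hF]
  generalize (q : ℝ) ^ (n - k) = Q at *
  have hQ : 0 < Q := by linarith
  have hm : (0 : ℝ) < P.card := lt_of_lt_of_le (by positivity) hP
  have hs : 1 < ε * (P.card / Q) := by
    have : θ ≤ P.card / Q := by rwa [le_div_iff₀ hQ]
    nlinarith
  have hrank : Module.finrank F (Fin n → F) =
      Module.finrank F ((Fin k → F) × (Fin (n - k) → F)) := by
    simp only [Module.finrank_prod, Module.finrank_fin_fun]
    omega
  let ψ := LinearEquiv.ofFinrankEq _ _ hrank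
  obtain ⟨d, t, E, hd2, hdk, ht, htQ, hedges, hE, hcodeg⟩ :=
    exists_family_of_flat_subsets ψ (Module.finrank_fin_fun F) hr P
      (by rwa [Module.finrank_fin_fun]) hs
  refine ⟨E, ?_, hE, ?_, ?_⟩
  · rw [← Finset.card_pos]
    by_contra h0
    have h1 : E.card = 0 := by omega
    have h2 : 0 < Q ^ d * t ^ r := by positivity
    rw [h1, Nat.cast_zero, mul_zero] at hedges
    linarith
  · intro i hi2 hir I _ hIi
    have hset : {e : Finset (Fin n → F) | e ∈ E ∧ I ⊆ e} =
        ((E.filter fun e => I ⊆ e : Finset (Finset (Fin n → F))) : Set (Finset (Fin n → F))) := by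
      ext e
      simp
    rw [hset, Set.ncard_coe_finset]
    subst hIi
    refine codegree_bound hk hi2 hir hdk hd2 hε hε1 (by positivity) ht hm (Nat.cast_nonneg _)
      (Nat.cast_nonneg _) hc hθdef hθε hq1 hqQ hqc htQ hedges ?_
    convert hcodeg I hir
  · intro x _
    have hset : {e : Finset (Fin n → F) | e ∈ E ∧ x ∈ e} =
        ((E.filter fun e => {x} ⊆ e : Finset (Finset (Fin n → F))) :
          Set (Finset (Fin n → F))) := by
      ext e
      simp
    rw [hset, Set.ncard_coe_finset]
    have h1 := hcodeg {x} (by simp; omega)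
    rw [Finset.card_singleton] at h1
    refine degree_bound (by omega) hdk (by omega) hε hε1 (by positivity) ht hm hQ
      (Nat.cast_nonneg _) hθdef htQ hedges ?_
    convert h1
end

section
/- Let F be a field, V a vector space over F regarded as an affine space, S ⊆ V a finite set with |S| ≥ 2, and u, v ∈ V \ S with u ≠ v. If S ∪ {u} is affinely independent, then there exists w ∈ S such that (S \ {w}) ∪ {u, v} is affinely independent. -/
/-- Adding a point outside the affine span of an affinely independent set keeps it affinely
independent. -/
theorem affineIndependent_insert_of_notMem_affineSpan {F V : Type*} [Field F] [AddCommGroup V]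
    [Module F V] {A : Set V} {x : V} (hA : AffineIndependent F ((↑) : A → V))
    (hx : x ∉ affineSpan F A) : AffineIndependent F ((↑) : ↥(insert x A) → V) := by
  have hmem (y : {y : (insert x A : Set V) // y ≠ ⟨x, Set.mem_insert x A⟩}) : (y : V) ∈ A :=
    y.1.2.resolve_left fun h => y.2 (Subtype.ext h)
  refine AffineIndependent.affineIndependent_of_notMem_span
    (i := (⟨x, Set.mem_insert x A⟩ : (insert x A : Set V))) ?_ ?_
  · exact hA.comp_embedding
      ⟨fun y => ⟨y, hmem y⟩, fun a b h => Subtype.ext (Subtype.ext (Subtype.mk.inj h))⟩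
  · refine fun h => hx (affineSpan_mono F ?_ h)
    rintro _ ⟨y, hy, rfl⟩
    exact hmem ⟨y, hy⟩

/-- The affine spans of two subsets of an affinely independent set meet in the affine span of
the intersection. -/
theorem mem_affineSpan_inter_of_affineIndependent {F V : Type*} [Field F] [AddCommGroup V]
    [Module F V] {A B C : Set V} {x : V} (hA : AffineIndependent F ((↑) : A → V))
    (hB : B ⊆ A) (hC : C ⊆ A) (hxB : x ∈ affineSpan F B) (hxC : x ∈ affineSpan F C) :
    x ∈ affineSpan F (B ∩ C) := by
  have h := hA.inf_affineSpan_eq_affineSpan_inter ((↑) ⁻¹' B) ((↑) ⁻¹' C)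
  rw [← Set.preimage_inter, Subtype.image_preimage_coe, Subtype.image_preimage_coe,
    Subtype.image_preimage_coe, Set.inter_eq_right.2 hB, Set.inter_eq_right.2 hC,
    Set.inter_eq_right.2 (Set.inter_subset_left.trans hB)] at h
  exact h ▸ ⟨hxB, hxC⟩

/-- A point in the affine span of an affinely independent set `A` which remains in the span after
deleting any single point of a finite set `T` lies in the affine span of `A \ T`. -/
theorem mem_affineSpan_sdiff_of_forall_mem {F V : Type*} [Field F] [AddCommGroup V]
    [Module F V] {A T : Set V} {x : V} (hA : AffineIndependent F ((↑) : A → V))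
    (hT : T.Finite) (hx : x ∈ affineSpan F A) (h : ∀ t ∈ T, x ∈ affineSpan F (A \ {t})) :
    x ∈ affineSpan F (A \ T) := by
  induction T, hT using Set.Finite.induction_on with
  | empty => simpa using hx
  | @insert a T _ _ ih =>
    have h' := mem_affineSpan_inter_of_affineIndependent hA Set.sdiff_subset Set.sdiff_subset
      (h a (Set.mem_insert a T)) (ih fun t ht => h t (Set.mem_insert_of_mem a ht))
    refine affineSpan_mono F ?_ h'
    rintro y ⟨⟨hy, hya⟩, -, hyT⟩
    exact ⟨hy, by rintro (rfl | hyMem); exacts [hya rfl, hyT hyMem]⟩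

/-- Let `F` be a field, `V` a vector space over `F` (regarded as an affine
space over itself), `S ⊆ V` a finite set with `|S| ≥ 2`, and `u, v ∈ V \ S` with `u ≠ v`.
If `S ∪ {u}` is affinely independent, then there exists `w ∈ S` such that
`(S \ {w}) ∪ {u, v}` is affinely independent. -/
theorem statement11 (F : Type*) [Field F] (V : Type*) [AddCommGroup V] [Module F V]
    (S : Set V) (hfin : S.Finite) (h2 : 2 ≤ S.ncard)
    (u v : V) (hu : u ∉ S) (hv : v ∉ S) (huv : u ≠ v)
    (hind : AffineIndependent F ((↑) : (S ∪ {u} : Set V) → V)) :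
    ∃ w ∈ S, AffineIndependent F ((↑) : ((S \ {w}) ∪ {u, v} : Set V) → V) := by
  obtain ⟨a, ha⟩ : S.Nonempty := Set.nonempty_of_ncard_ne_zero (by omega)
  by_cases h : ∀ t ∈ S, v ∈ affineSpan F ((S ∪ {u}) \ {t})
  · have hspan := mem_affineSpan_sdiff_of_forall_mem hind hfin
      (affineSpan_mono F Set.sdiff_subset (h a ha)) h
    have hsub : (S ∪ {u}) \ S ⊆ {u} := by
      rintro y ⟨hy | hy, hyS⟩
      exacts [absurd hy hyS, hy]
    have hvu := affineSpan_mono F hsub hspan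
    rw [AffineSubspace.mem_affineSpan_singleton] at hvu
    exact absurd hvu.symm huv
  · push Not at h
    obtain ⟨w, hw, hvw⟩ := h
    refine ⟨w, hw, ?_⟩
    have hind' := affineIndependent_insert_of_notMem_affineSpan (hind.mono Set.sdiff_subset) hvw
    refine hind'.mono ?_
    rintro y (⟨hy, hyw⟩ | rfl | rfl)
    · exact Or.inr ⟨Or.inl hy, hyw⟩
    · exact Or.inr ⟨Or.inr rfl, fun h => hu (h ▸ hw)⟩
    · exact Or.inl rfl
end
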